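/- Let n ≥ 1, let Ω ⊆ ℝⁿ be an open set, and let f : Ω → ℝ be a smooth function whose Hessian matrix H(x) = (∂²f/∂xᵢ∂xⱼ(x)) is positive definite at every x ∈ Ω. Assume f is affine Kähler Ricci flat, i.e. ∂²(log det H)/∂xᵢ∂xⱼ ≡ 0 on Ω for all i, j, and assume the Calabi metric g = Σ fᵢⱼ dxᵢ dxⱼ on Ω is complete. Then f is a quadratic polynomial: there exist a symmetric positive definite n×n real matrix A, a vector b ∈ ℝⁿ, and c ∈ ℝ such that f(x) = (1/2)⟨Ax, x⟩ + ⟨b, x⟩ + c for all x ∈ Ω. -/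

import Mathlib

open Matrix

/-- Partial derivative `∂u/∂xᵢ` of a function `u : ℝⁿ → ℝ`. -/
noncomputable def pder (n : ℕ) (i : Fin n) (u : (Fin n → ℝ) → ℝ) (x : Fin n → ℝ) : ℝ :=
  fderiv ℝ u x (Pi.single i 1)

/-- Hessian matrix `H(x) = (∂²f/∂xᵢ∂xⱼ(x))`. -/
noncomputable def Hess (n : ℕ) (f : (Fin n → ℝ) → ℝ) (x : Fin n → ℝ) :
    Matrix (Fin n) (Fin n) ℝ :=
  Matrix.of fun i j => pder n i (pder n j f) x

/-- `ρ = (det H)^(−1/(n+2))`. -/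
noncomputable def rho (n : ℕ) (f : (Fin n → ℝ) → ℝ) (x : Fin n → ℝ) : ℝ :=
  (Hess n f x).det ^ (-(1 : ℝ) / ((n : ℝ) + 2))

/-- `⟨∇u, ∇v⟩_g = Σᵢⱼ H^{ij} ∂ᵢu ∂ⱼv` with respect to the Calabi metric of `f`. -/
noncomputable def gradInner (n : ℕ) (f u v : (Fin n → ℝ) → ℝ) (x : Fin n → ℝ) : ℝ :=
  ∑ i, ∑ j, (Hess n f x)⁻¹ i j * pder n i u x * pder n j v x

/-- `Φ = ‖∇ρ‖²_g / ρ²`. -/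
noncomputable def Phi (n : ℕ) (f : (Fin n → ℝ) → ℝ) (x : Fin n → ℝ) : ℝ :=
  gradInner n f (rho n f) (rho n f) x / (rho n f x) ^ 2

/-- Laplace–Beltrami operator of the Calabi metric:
`Δ_g u = (det H)^{−1/2} Σᵢ ∂ᵢ( (det H)^{1/2} Σⱼ H^{ij} ∂ⱼu )`. -/
noncomputable def lapBel (n : ℕ) (f u : (Fin n → ℝ) → ℝ) (x : Fin n → ℝ) : ℝ :=
  (Hess n f x).det ^ (-(1 : ℝ) / 2) *
    ∑ i, pder n i (fun y => (Hess n f y).det ^ ((1 : ℝ) / 2) *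
      ∑ j, (Hess n f y)⁻¹ i j * pder n j u y) x

/-- Completeness of the Calabi metric `g = Σ fᵢⱼ dxᵢ dxⱼ` on `Ω`: every C¹ curve
`γ : [0,1) → Ω` eventually leaving every compact subset of `Ω` has infinite length. -/
def CalabiComplete (n : ℕ) (Ω : Set (Fin n → ℝ)) (f : (Fin n → ℝ) → ℝ) : Prop :=
  ∀ γ : ℝ → (Fin n → ℝ), ContDiffOn ℝ 1 γ (Set.Ico (0 : ℝ) 1) →
    (∀ t ∈ Set.Ico (0 : ℝ) 1, γ t ∈ Ω) →
    (∀ K : Set (Fin n → ℝ), K ⊆ Ω → IsCompact K →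
      ∃ t₀, t₀ < 1 ∧ ∀ t, t₀ < t → t < 1 → γ t ∉ K) →
    ∫⁻ t in Set.Ioo (0 : ℝ) 1,
      ENNReal.ofReal (Real.sqrt ((Hess n f (γ t)).mulVec (deriv γ t) ⬝ᵥ deriv γ t)) = ⊤

/-- `f` coincides on `Ω` with a quadratic polynomial with symmetric positive definite
quadratic part. -/
def IsQuadraticOn (n : ℕ) (Ω : Set (Fin n → ℝ)) (f : (Fin n → ℝ) → ℝ) : Prop :=
  ∃ A : Matrix (Fin n) (Fin n) ℝ, A.IsSymm ∧ A.PosDef ∧ ∃ b : Fin n → ℝ, ∃ c : ℝ,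
    ∀ x ∈ Ω, f x = (1 / 2) * (A.mulVec x ⬝ᵥ x) + b ⬝ᵥ x + c


section piecea
open Matrix Set Filter Topology
open scoped ContDiff

set_option synthInstance.maxHeartbeats 400000
set_option synthInstance.maxSize 1000
set_option maxHeartbeats 1000000
set_option maxSynthPendingDepth 10
set_option linter.unusedVariables false
section calcs
variable {E : Type*} [NormedAddCommGroup E] [NormedSpace ℝ E]

noncomputable def D2 (f : E → ℝ) : E → E →L[ℝ] E →L[ℝ] ℝ := fderiv ℝ (fderiv ℝ f)
noncomputable def D3 (f : E → ℝ) : E → E →L[ℝ] E →L[ℝ] E →L[ℝ] ℝ := fderiv ℝ (D2 f)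
noncomputable def D4 (f : E → ℝ) : E → E →L[ℝ] E →L[ℝ] E →L[ℝ] E →L[ℝ] ℝ := fderiv ℝ (D3 f)
noncomputable def D5 (f : E → ℝ) : E → E →L[ℝ] E →L[ℝ] E →L[ℝ] E →L[ℝ] E →L[ℝ] ℝ :=
  fderiv ℝ (D4 f)

variable {F : Type*} [NormedAddCommGroup F] [NormedSpace ℝ F]

theorem smooth_fderiv {g : E → F} {Ω : Set E} (hΩ : IsOpen Ω) (hg : ContDiffOn ℝ (⊤ : ℕ∞) g Ω) :
    ContDiffOn ℝ (⊤ : ℕ∞) (fderiv ℝ g) Ω := hg.fderiv_of_isOpen hΩ (by norm_cast)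

theorem smooth_hasFDerivAt {g : E → F} {Ω : Set E} (hΩ : IsOpen Ω)
    (hg : ContDiffOn ℝ (⊤ : ℕ∞) g Ω) {x : E} (hx : x ∈ Ω) :
    HasFDerivAt g (fderiv ℝ g x) x :=
  ((hg.contDiffAt (hΩ.mem_nhds hx)).differentiableAt (by simp)).hasFDerivAt

theorem smooth_symm {g : E → F} {Ω : Set E} (hΩ : IsOpen Ω)
    (hg : ContDiffOn ℝ (⊤ : ℕ∞) g Ω) {x : E} (hx : x ∈ Ω) (u v : E) :
    fderiv ℝ (fderiv ℝ g) x u v = fderiv ℝ (fderiv ℝ g) x v u := by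
  have h := (hg.contDiffAt (hΩ.mem_nhds hx)).isSymmSndFDerivAt
    (by simp only [minSmoothness_of_isRCLikeNormedField]; norm_cast)
  exact h.eq u v

/-- derivative of an identity valid on an open set -/
theorem fderiv_eq_of_eqOn {g h : E → ℝ} {Ω : Set E} (hΩ : IsOpen Ω) (hgh : ∀ x ∈ Ω, g x = h x)
    {x : E} (hx : x ∈ Ω) : fderiv ℝ g x = fderiv ℝ h x :=
  Filter.EventuallyEq.fderiv_eq (by filter_upwards [hΩ.mem_nhds hx] with y hy using hgh y hy)

variable {Ω : Set E} {f : E → ℝ} 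

theorem D1s (hΩ : IsOpen Ω) (hf : ContDiffOn ℝ (⊤ : ℕ∞) f Ω) :
  ContDiffOn ℝ (⊤ : ℕ∞) (fderiv ℝ f) Ω := smooth_fderiv hΩ hf
theorem D2s (hΩ : IsOpen Ω) (hf : ContDiffOn ℝ (⊤ : ℕ∞) f Ω) :
  ContDiffOn ℝ (⊤ : ℕ∞) (D2 f) Ω := smooth_fderiv hΩ (D1s hΩ hf)
theorem D3s (hΩ : IsOpen Ω) (hf : ContDiffOn ℝ (⊤ : ℕ∞) f Ω) :
  ContDiffOn ℝ (⊤ : ℕ∞) (D3 f) Ω := smooth_fderiv hΩ (D2s hΩ hf)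
theorem D4s (hΩ : IsOpen Ω) (hf : ContDiffOn ℝ (⊤ : ℕ∞) f Ω) :
  ContDiffOn ℝ (⊤ : ℕ∞) (D4 f) Ω := smooth_fderiv hΩ (D3s hΩ hf)

theorem D1h (hΩ : IsOpen Ω) (hf : ContDiffOn ℝ (⊤ : ℕ∞) f Ω) {x : E} (hx : x ∈ Ω) :
  HasFDerivAt (fderiv ℝ f) (D2 f x) x := smooth_hasFDerivAt hΩ (D1s hΩ hf) hx
theorem D2h (hΩ : IsOpen Ω) (hf : ContDiffOn ℝ (⊤ : ℕ∞) f Ω) {x : E} (hx : x ∈ Ω) :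
  HasFDerivAt (D2 f) (D3 f x) x := smooth_hasFDerivAt hΩ (D2s hΩ hf) hx
theorem D3h (hΩ : IsOpen Ω) (hf : ContDiffOn ℝ (⊤ : ℕ∞) f Ω) {x : E} (hx : x ∈ Ω) :
  HasFDerivAt (D3 f) (D4 f x) x := smooth_hasFDerivAt hΩ (D3s hΩ hf) hx
theorem D4h (hΩ : IsOpen Ω) (hf : ContDiffOn ℝ (⊤ : ℕ∞) f Ω) {x : E} (hx : x ∈ Ω) :
  HasFDerivAt (D4 f) (D5 f x) x := smooth_hasFDerivAt hΩ (D4s hΩ hf) hx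

/-- evaluation along a curve -/
theorem hasDerivAt_line {g : E → F} {g' : E →L[ℝ] F} {γ : ℝ → E} {γ' : E} {t : ℝ}
    (hg : HasFDerivAt g g' (γ t)) (hγ : HasDerivAt γ γ' t) :
    HasDerivAt (fun t => g (γ t)) (g' γ') t := hg.comp_hasDerivAt t hγ

theorem hasFDerivAt_ap {g : E → E →L[ℝ] F} {g' : E →L[ℝ] E →L[ℝ] F} {x : E}
    (hg : HasFDerivAt g g' x) (u : E) : HasFDerivAt (fun y => g y u) (g'.flip u) x := by
  have := hg.clm_apply (hasFDerivAt_const u x)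
  simpa using this

theorem D2_symm (hΩ : IsOpen Ω) (hf : ContDiffOn ℝ (⊤ : ℕ∞) f Ω) {x : E} (hx : x ∈ Ω) (u v : E) :
    D2 f x u v = D2 f x v u := smooth_symm hΩ hf hx u v

theorem D3_symm12 (hΩ : IsOpen Ω) (hf : ContDiffOn ℝ (⊤ : ℕ∞) f Ω) {x : E} (hx : x ∈ Ω)
    (u v w : E) : D3 f x u v w = D3 f x v u w := by
  have := smooth_symm hΩ (D1s hΩ hf) hx u v
  exact congrArg (fun L => L w) this

theorem D3_symm23 (hΩ : IsOpen Ω) (hf : ContDiffOn ℝ (⊤ : ℕ∞) f Ω) {x : E} (hx : x ∈ Ω)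
    (u v w : E) : D3 f x u v w = D3 f x u w v := by
  have h := fderiv_eq_of_eqOn hΩ (fun y hy => D2_symm hΩ hf hy v w) hx
  rw [(hasFDerivAt_ap (hasFDerivAt_ap (D2h hΩ hf hx) v) w).fderiv,
    (hasFDerivAt_ap (hasFDerivAt_ap (D2h hΩ hf hx) w) v).fderiv] at h
  simpa using congrArg (fun L => L u) h

theorem D4_symm12 (hΩ : IsOpen Ω) (hf : ContDiffOn ℝ (⊤ : ℕ∞) f Ω) {x : E} (hx : x ∈ Ω)
    (a u v w : E) : D4 f x a u v w = D4 f x u a v w := by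
  have := smooth_symm hΩ (D2s hΩ hf) hx a u
  exact congrArg (fun L => L v w) this

theorem D4_symm23 (hΩ : IsOpen Ω) (hf : ContDiffOn ℝ (⊤ : ℕ∞) f Ω) {x : E} (hx : x ∈ Ω)
    (a u v w : E) : D4 f x a u v w = D4 f x a v u w := by
  have h := fderiv_eq_of_eqOn hΩ (fun y hy => D3_symm12 hΩ hf hy u v w) hx
  rw [(hasFDerivAt_ap (hasFDerivAt_ap (hasFDerivAt_ap (D3h hΩ hf hx) u) v) w).fderiv,
    (hasFDerivAt_ap (hasFDerivAt_ap (hasFDerivAt_ap (D3h hΩ hf hx) v) u) w).fderiv] at h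
  simpa using congrArg (fun L => L a) h

theorem D4_symm34 (hΩ : IsOpen Ω) (hf : ContDiffOn ℝ (⊤ : ℕ∞) f Ω) {x : E} (hx : x ∈ Ω)
    (a u v w : E) : D4 f x a u v w = D4 f x a u w v := by
  have h := fderiv_eq_of_eqOn hΩ (fun y hy => D3_symm23 hΩ hf hy u v w) hx
  rw [(hasFDerivAt_ap (hasFDerivAt_ap (hasFDerivAt_ap (D3h hΩ hf hx) u) v) w).fderiv,
    (hasFDerivAt_ap (hasFDerivAt_ap (hasFDerivAt_ap (D3h hΩ hf hx) u) w) v).fderiv] at h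
  simpa using congrArg (fun L => L a) h

theorem D5_symm12 (hΩ : IsOpen Ω) (hf : ContDiffOn ℝ (⊤ : ℕ∞) f Ω) {x : E} (hx : x ∈ Ω)
    (b a u v w : E) : D5 f x b a u v w = D5 f x a b u v w := by
  have := smooth_symm hΩ (D3s hΩ hf) hx b a
  exact congrArg (fun L => L u v w) this

theorem D5_of_D4 (hΩ : IsOpen Ω) (hf : ContDiffOn ℝ (⊤ : ℕ∞) f Ω) {x : E} (hx : x ∈ Ω)
    (b a u v w a' u' v' w' : E) (h : ∀ y ∈ Ω, D4 f y a u v w = D4 f y a' u' v' w') :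
    D5 f x b a u v w = D5 f x b a' u' v' w' := by
  have h := fderiv_eq_of_eqOn hΩ h hx
  rw [(hasFDerivAt_ap (hasFDerivAt_ap (hasFDerivAt_ap (hasFDerivAt_ap
      (D4h hΩ hf hx) a) u) v) w).fderiv,
    (hasFDerivAt_ap (hasFDerivAt_ap (hasFDerivAt_ap (hasFDerivAt_ap
      (D4h hΩ hf hx) a') u') v') w').fderiv] at h
  simpa using congrArg (fun L => L b) h

theorem D4_swap (hΩ : IsOpen Ω) (hf : ContDiffOn ℝ (⊤ : ℕ∞) f Ω) {x : E} (hx : x ∈ Ω)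
    (a v : E) : ∀ b, D4 f x v v a b = D4 f x a b v v := by
  intro b
  rw [D4_symm23 hΩ hf hx, D4_symm34 hΩ hf hx, D4_symm12 hΩ hf hx, D4_symm23 hΩ hf hx]

theorem D5_swap (hΩ : IsOpen Ω) (hf : ContDiffOn ℝ (⊤ : ℕ∞) f Ω) {x : E} (hx : x ∈ Ω)
    (e v : E) : D5 f x v v v e e = D5 f x e e v v v := by
  rw [D5_of_D4 hΩ hf hx v v v e e e e v v (fun y hy => D4_swap hΩ hf hy e v e),
    D5_symm12 hΩ hf hx]
  refine D5_of_D4 hΩ hf hx _ _ _ _ _ _ _ _ _ (fun y hy => ?_)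
  rw [D4_symm12 hΩ hf hy]

end calcs

/-- second derivative test -/
theorem second_deriv_test {g g' : ℝ → ℝ} {c : ℝ} (h1 : ∀ᶠ t in 𝓝 0, HasDerivAt g (g' t) t)
    (h2 : HasDerivAt g' c 0) (hmax : IsLocalMax g 0) : c ≤ 0 := by
  by_contra hc
  push Not at hc
  have e1 : deriv g =ᶠ[𝓝 0] g' := by filter_upwards [h1] with t ht using ht.deriv
  have e2 : deriv (deriv g) 0 = c := by rw [e1.deriv_eq, h2.deriv]
  have h0 : deriv g 0 = 0 := hmax.deriv_eq_zero
  have hmin := isLocalMin_of_deriv_deriv_pos (e2 ▸ hc) h0 h1.self_of_nhds.continuousAt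
  have hconst : g =ᶠ[𝓝 0] fun _ => g 0 := by
    filter_upwards [hmin, hmax] with t h1 h2 using le_antisymm h2 h1
  have : deriv g =ᶠ[𝓝 0] fun _ => 0 := by
    have := hconst.deriv
    simpa using this
  rw [this.deriv_eq] at e2
  simp at e2
  linarith
end piecea

section pieceb
open Matrix Set Filter Topology
open scoped ContDiff

section matd
variable {n : ℕ}

def MD (N : ℝ → Matrix (Fin n) (Fin n) ℝ) (N' : Matrix (Fin n) (Fin n) ℝ) (t : ℝ) : Prop :=
  ∀ i j, HasDerivAt (fun s => N s i j) (N' i j) t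

theorem MD.mul {N M : ℝ → Matrix (Fin n) (Fin n) ℝ} {N' M' : Matrix (Fin n) (Fin n) ℝ} {t : ℝ}
    (hN : MD N N' t) (hM : MD M M' t) : MD (fun s => N s * M s) (N' * M t + N t * M') t := by
  intro i j
  simp only [Matrix.mul_apply, Matrix.add_apply]
  rw [← Finset.sum_add_distrib]
  exact HasDerivAt.fun_sum (fun k _ => (hN i k).mul (hM k j))

theorem MD.trace {N : ℝ → Matrix (Fin n) (Fin n) ℝ} {N' : Matrix (Fin n) (Fin n) ℝ} {t : ℝ}
    (hN : MD N N' t) : HasDerivAt (fun s => (N s).trace) N'.trace t := by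
  simp only [Matrix.trace, Matrix.diag]
  exact HasDerivAt.fun_sum (fun k _ => hN k k)

theorem MD.det {N : ℝ → Matrix (Fin n) (Fin n) ℝ} {N' : Matrix (Fin n) (Fin n) ℝ} {t : ℝ}
    (hN : MD N N' t) : HasDerivAt (fun s => (N s).det) ((adjugate (N t) * N').trace) t := by
  let D : ContinuousMultilinearMap ℝ (fun _ : Fin n => (Fin n → ℝ)) ℝ :=
    ⟨(Matrix.detRowAlternating (R := ℝ) (n := Fin n)).toMultilinearMap, by
      show Continuous fun A : Matrix (Fin n) (Fin n) ℝ => A.det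
      exact Continuous.matrix_det continuous_id⟩
  let N₁ : ℝ → (Fin n → Fin n → ℝ) := fun s i j => N s i j
  have hN1 : HasDerivAt N₁ (fun i j => N' i j) t :=
    hasDerivAt_pi.2 fun i => hasDerivAt_pi.2 fun j => hN i j
  have h := (D.hasFDerivAt (N₁ t)).comp_hasDerivAt t hN1
  have e : D.linearDeriv (N₁ t) (fun i j => N' i j) = (adjugate (N t) * N').trace := by
    rw [ContinuousMultilinearMap.linearDeriv_apply]
    have : ∀ i, D (Function.update (N₁ t) i (N' i)) = ∑ j, adjugate (N t) j i * N' i j := by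
      intro i
      have h1 : D (Function.update (N₁ t) i (N' i)) = cramer (N t)ᵀ (N' i) i := by
        rw [cramer_transpose_apply]; rfl
      rw [h1, cramer_eq_adjugate_mulVec, ← adjugate_transpose]
      simp [Matrix.mulVec, dotProduct]
    simp only [this, Matrix.trace, Matrix.diag, Matrix.mul_apply]
    rw [Finset.sum_comm]
  rw [e] at h
  exact h

theorem MD.const (A : Matrix (Fin n) (Fin n) ℝ) (t : ℝ) : MD (fun _ => A) 0 t :=
  fun i j => by simpa using hasDerivAt_const t (A i j)

theorem MD.inv {N : ℝ → Matrix (Fin n) (Fin n) ℝ} {N' : Matrix (Fin n) (Fin n) ℝ} {t : ℝ}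
    (hN : MD N N' t) (hd : (N t).det ≠ 0) :
    MD (fun s => (N s)⁻¹) (-((N t)⁻¹ * N' * (N t)⁻¹)) t := by
  have hdet := hN.det
  have hadj : ∀ i j, DifferentiableAt ℝ (fun s => adjugate (N s) i j) t := by
    intro i j
    simp only [adjugate_apply]
    have : MD (fun s => (N s).updateRow j (Pi.single i 1)) (N'.updateRow j 0) t := by
      intro a b
      by_cases h : a = j
      · subst h; simpa using hasDerivAt_const t _
      · simpa [h] using hN a b
    exact this.det.differentiableAt
  have hdiff : ∀ i j, DifferentiableAt ℝ (fun s => (N s)⁻¹ i j) t := by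
    intro i j
    have : (fun s => (N s)⁻¹ i j) = fun s => ((N s).det)⁻¹ * adjugate (N s) i j := by
      ext s; simp [Matrix.inv_def]
    rw [this]
    exact (hdet.differentiableAt.inv hd).mul (hadj i j)
  let B' : Matrix (Fin n) (Fin n) ℝ := Matrix.of fun i j => deriv (fun s => (N s)⁻¹ i j) t
  have hB : MD (fun s => (N s)⁻¹) B' t := fun i j => (hdiff i j).hasDerivAt
  have hmul := hB.mul hN
  have hev : ∀ᶠ s in 𝓝 t, (N s)⁻¹ * N s = 1 := by
    filter_upwards [hdet.continuousAt.eventually_ne hd] with s hs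
    exact Matrix.nonsing_inv_mul _ (isUnit_iff_ne_zero.2 hs)
  have hz : B' * N t + (N t)⁻¹ * N' = 0 := by
    ext i j
    have h1 := hmul i j
    have h2 : HasDerivAt (fun s => ((N s)⁻¹ * N s) i j) 0 t := by
      refine (hasDerivAt_const t ((1 : Matrix (Fin n) (Fin n) ℝ) i j)).congr_of_eventuallyEq ?_
      filter_upwards [hev] with s hs
      rw [hs]
    simpa using h1.unique h2
  have hE : B' = -((N t)⁻¹ * N' * (N t)⁻¹) := by
    have h1 : B' * N t = -((N t)⁻¹ * N') := eq_neg_of_add_eq_zero_left hz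
    calc B' = B' * N t * (N t)⁻¹ := by
            rw [Matrix.mul_assoc, Matrix.mul_nonsing_inv _ (isUnit_iff_ne_zero.2 hd), mul_one]
      _ = _ := by rw [h1, Matrix.neg_mul]
  rw [← hE]; exact hB

theorem logdet_identities {N N1 N2 : ℝ → Matrix (Fin n) (Fin n) ℝ}
    {N3 : Matrix (Fin n) (Fin n) ℝ} {h : ℝ}
    (hd : ∀ᶠ t in 𝓝 (0 : ℝ), 0 < (N t).det)
    (h1 : ∀ᶠ t in 𝓝 (0 : ℝ), MD N (N1 t) t) (h2 : ∀ᶠ t in 𝓝 (0 : ℝ), MD N1 (N2 t) t)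
    (h3 : MD N2 N3 0)
    (hl : ∀ᶠ t in 𝓝 (0 : ℝ), HasDerivAt (fun s => Real.log (N s).det) h t) :
    ((N 0)⁻¹ * N2 0).trace = ((N 0)⁻¹ * N1 0 * (N 0)⁻¹ * N1 0).trace ∧
    ((N 0)⁻¹ * N3).trace - 3 * ((N 0)⁻¹ * N1 0 * (N 0)⁻¹ * N2 0).trace
      + 2 * ((N 0)⁻¹ * N1 0 * (N 0)⁻¹ * N1 0 * (N 0)⁻¹ * N1 0).trace = 0 := by
  have e1 : ∀ᶠ t in 𝓝 (0 : ℝ), ((N t)⁻¹ * N1 t).trace = h := by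
    filter_upwards [hd, h1, hl] with t a b c
    have := (b.det.log a.ne').unique c
    rw [← this, Matrix.inv_def]
    simp [Matrix.trace_smul, div_eq_inv_mul]
  have d1 : ∀ᶠ t in 𝓝 (0 : ℝ), HasDerivAt (fun s => ((N s)⁻¹ * N1 s).trace)
      (((N t)⁻¹ * N2 t).trace - ((N t)⁻¹ * N1 t * (N t)⁻¹ * N1 t).trace) t := by
    filter_upwards [hd, h1, h2] with t a b c
    have := ((b.inv a.ne').mul c).trace
    convert this using 1
    rw [Matrix.trace_add, Matrix.neg_mul, Matrix.trace_neg]; ring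
  have e2 : ∀ᶠ t in 𝓝 (0 : ℝ),
      ((N t)⁻¹ * N2 t).trace - ((N t)⁻¹ * N1 t * (N t)⁻¹ * N1 t).trace = 0 := by
    filter_upwards [e1.eventually_nhds, d1] with t a b
    refine b.unique ((hasDerivAt_const t h).congr_of_eventuallyEq ?_)
    filter_upwards [a] with s hs using hs
  refine ⟨sub_eq_zero.1 e2.self_of_nhds, ?_⟩
  have i0 := (h1.self_of_nhds.inv hd.self_of_nhds.ne')
  have m2 := (i0.mul h3).trace
  have m11 := i0.mul h2.self_of_nhds
  have m1 := (((i0.mul h2.self_of_nhds).mul i0).mul h2.self_of_nhds).trace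
  have := (m2.sub m1).unique ((hasDerivAt_const 0 (0 : ℝ)).congr_of_eventuallyEq
    (by filter_upwards [e2] with s hs using hs))
  generalize (N 0)⁻¹ = B at *
  generalize N1 0 = X at *
  generalize N2 0 = Y at *
  simp only [Matrix.neg_mul, Matrix.mul_neg, Matrix.add_mul, Matrix.mul_add, Matrix.trace_add,
    Matrix.trace_neg, Matrix.mul_assoc] at this ⊢
  have c1 : (B * (Y * (B * X))).trace = (B * (X * (B * Y))).trace := by
    rw [← Matrix.mul_assoc, Matrix.trace_mul_comm]; simp only [Matrix.mul_assoc]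
  rw [c1] at this
  linarith
end matd
end pieceb

section piecec
open Matrix Set Filter Topology
open scoped ContDiff
set_option synthInstance.maxHeartbeats 400000
set_option synthInstance.maxSize 1000
set_option maxHeartbeats 1000000
set_option maxSynthPendingDepth 10
set_option linter.unusedVariables false

section hess
variable {n : ℕ} {Ω : Set (Fin n → ℝ)} {f : (Fin n → ℝ) → ℝ}

theorem pder2_eq (hΩ : IsOpen Ω) (hf : ContDiffOn ℝ (⊤ : ℕ∞) f Ω) {x : Fin n → ℝ} (hx : x ∈ Ω)
    (i j : Fin n) : pder n i (pder n j f) x = D2 f x (Pi.single i 1) (Pi.single j 1) := by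
  have := (hasFDerivAt_ap (D1h hΩ hf hx) (Pi.single j 1)).fderiv
  unfold pder
  rw [this]; simp

theorem Hess_apply (hΩ : IsOpen Ω) (hf : ContDiffOn ℝ (⊤ : ℕ∞) f Ω) {x : Fin n → ℝ} (hx : x ∈ Ω)
    (i j : Fin n) : Hess n f x i j = D2 f x (Pi.single i 1) (Pi.single j 1) := by
  simp [Hess, pder2_eq hΩ hf hx]

theorem vec_expand (v : Fin n → ℝ) : v = ∑ i, v i • (Pi.single i (1 : ℝ) : Fin n → ℝ) := by
  ext j
  simp [Finset.sum_apply, Pi.single_apply]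

theorem bil_expand (B : (Fin n → ℝ) →L[ℝ] (Fin n → ℝ) →L[ℝ] ℝ) (u v : Fin n → ℝ) :
    B u v = ∑ i, ∑ j, u i * v j * B (Pi.single i 1) (Pi.single j 1) := by
  conv_lhs => rw [vec_expand u, vec_expand v]
  simp only [map_sum, map_smul, _root_.sum_apply, _root_.smul_apply,
    smul_eq_mul]
  rw [Finset.sum_comm]
  refine Finset.sum_congr rfl fun i _ => ?_
  try rw [Finset.mul_sum]
  refine Finset.sum_congr rfl fun j _ => ?_
  ring

theorem Hess_quad (hΩ : IsOpen Ω) (hf : ContDiffOn ℝ (⊤ : ℕ∞) f Ω) {x : Fin n → ℝ} (hx : x ∈ Ω)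
    (v : Fin n → ℝ) : (Hess n f x).mulVec v ⬝ᵥ v = D2 f x v v := by
  rw [bil_expand]
  simp only [Matrix.mulVec, dotProduct, Hess_apply hΩ hf hx]
  refine Finset.sum_congr rfl fun i _ => ?_
  rw [Finset.sum_mul]
  refine Finset.sum_congr rfl fun j _ => ?_
  ring

theorem D2_pos (hΩ : IsOpen Ω) (hf : ContDiffOn ℝ (⊤ : ℕ∞) f Ω)
    (hpos : ∀ x ∈ Ω, (Hess n f x).PosDef) {x : Fin n → ℝ} (hx : x ∈ Ω)
    {v : Fin n → ℝ} (hv : v ≠ 0) : 0 < D2 f x v v := by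
  have := (hpos x hx).dotProduct_mulVec_pos hv
  rw [← Hess_quad hΩ hf hx, dotProduct_comm]
  simpa using this

theorem logdet_smooth (hΩ : IsOpen Ω) (hf : ContDiffOn ℝ (⊤ : ℕ∞) f Ω)
    (hpos : ∀ x ∈ Ω, (Hess n f x).PosDef) :
    ContDiffOn ℝ (⊤ : ℕ∞) (fun y => Real.log (Hess n f y).det) Ω := by
  have he : ∀ i j, ContDiffOn ℝ (⊤ : ℕ∞) (fun y => Hess n f y i j) Ω := by
    intro i j
    have : ContDiffOn ℝ (⊤ : ℕ∞) (fun y => D2 f y (Pi.single i 1) (Pi.single j 1)) Ω :=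
      ((D2s hΩ hf).clm_apply contDiffOn_const).clm_apply contDiffOn_const
    exact this.congr fun y hy => Hess_apply hΩ hf hy i j
  refine ContDiffOn.log ?_ (fun x hx => (hpos x hx).det_pos.ne')
  simp only [Matrix.det_apply]
  refine ContDiffOn.sum fun σ _ => ?_
  refine ContDiffOn.const_smul _ ?_
  exact contDiffOn_prod fun i _ => he _ _

theorem line_mem (hΩ : IsOpen Ω) {y : Fin n → ℝ} (hy : y ∈ Ω) (v : Fin n → ℝ) :
    ∀ᶠ t in 𝓝 (0 : ℝ), y + t • v ∈ Ω := by
  have : Tendsto (fun t : ℝ => y + t • v) (𝓝 0) (𝓝 (y + (0 : ℝ) • v)) :=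
    Continuous.tendsto (by fun_prop) 0
  simp only [zero_smul, add_zero] at this
  exact this (hΩ.mem_nhds hy)

theorem line_hasDeriv (y v : Fin n → ℝ) (t : ℝ) : HasDerivAt (fun t : ℝ => y + t • v) v t := by
  simpa using ((hasDerivAt_id t).smul_const v).const_add y

theorem ric_line (hΩ : IsOpen Ω) (hf : ContDiffOn ℝ (⊤ : ℕ∞) f Ω)
    (hpos : ∀ x ∈ Ω, (Hess n f x).PosDef)
    (hric : ∀ x ∈ Ω, ∀ i j : Fin n,
      pder n i (pder n j (fun y => Real.log (Hess n f y).det)) x = 0)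
    {y : Fin n → ℝ} (hy : y ∈ Ω) (v : Fin n → ℝ) :
    ∃ h : ℝ, ∀ᶠ t in 𝓝 (0 : ℝ),
      HasDerivAt (fun s : ℝ => Real.log (Hess n f (y + s • v)).det) h t := by
  set g := fun y => Real.log (Hess n f y).det with hg
  have hgs : ContDiffOn ℝ (⊤ : ℕ∞) g Ω := logdet_smooth hΩ hf hpos
  obtain ⟨ε, hε, hball⟩ := Metric.eventually_nhds_iff_ball.1 (line_mem hΩ hy v)
  have hz : ∀ x ∈ Ω, D2 g x v v = 0 := by
    intro x hx
    rw [bil_expand]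
    refine Finset.sum_eq_zero fun i _ => Finset.sum_eq_zero fun j _ => ?_
    rw [← pder2_eq hΩ hgs hx, hric x hx, mul_zero]
  have hder : ∀ t ∈ Metric.ball (0 : ℝ) ε,
      HasDerivAt (fun s : ℝ => fderiv ℝ g (y + s • v) v) 0 t := by
    intro t ht
    have h1 := hasFDerivAt_ap (D1h hΩ hgs (hball t ht)) v
    have := hasDerivAt_line (g := fun z => fderiv ℝ g z v) h1 (line_hasDeriv y v t)
    simpa [hz _ (hball t ht)] using this
  obtain ⟨h, hh⟩ := Metric.isOpen_ball.exists_is_const_of_deriv_eq_zero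
    (convex_ball (0 : ℝ) ε).isPreconnected
    (fun t ht => (hder t ht).differentiableAt.differentiableWithinAt)
    (fun t ht => (hder t ht).deriv)
  refine ⟨h, ?_⟩
  filter_upwards [Metric.ball_mem_nhds (0 : ℝ) hε] with t ht
  have := hasDerivAt_line (smooth_hasFDerivAt hΩ hgs (hball t ht)) (line_hasDeriv y v t)
  rw [hh t ht] at this
  exact this

theorem exists_frame (hΩ : IsOpen Ω) (hf : ContDiffOn ℝ (⊤ : ℕ∞) f Ω)
    (hpos : ∀ x ∈ Ω, (Hess n f x).PosDef) {y : Fin n → ℝ} (hy : y ∈ Ω) :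
    ∃ C : Matrix (Fin n) (Fin n) ℝ, (Hess n f y)⁻¹ = C * Cᵀ ∧ Cᵀ * Hess n f y * C = 1 ∧
      C * C⁻¹ = 1 := by
  have hp := hpos y hy
  open scoped MatrixOrder Matrix.Norms.L2Operator in
  obtain ⟨L, hL, hH⟩ := CStarAlgebra.isStrictlyPositive_iff_eq_star_mul_self.mp
        hp.isStrictlyPositive
  have hLd : IsUnit L.det := (Matrix.isUnit_iff_isUnit_det L).1 hL
  have hs : star L = Lᵀ := by ext; simp [Matrix.star_apply]
  rw [hs] at hH
  have hLt : IsUnit Lᵀ.det := by simpa using hLd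
  refine ⟨L⁻¹, ?_, ?_, ?_⟩
  · rw [hH, Matrix.mul_inv_rev, Matrix.transpose_nonsing_inv]
  · rw [hH, Matrix.transpose_nonsing_inv, ← Matrix.mul_assoc, Matrix.nonsing_inv_mul _ hLt,
      Matrix.one_mul, Matrix.mul_nonsing_inv _ hLd]
  · rw [Matrix.nonsing_inv_nonsing_inv _ hLd, Matrix.nonsing_inv_mul _ hLd]

theorem conj_apply (B : (Fin n → ℝ) →L[ℝ] (Fin n → ℝ) →L[ℝ] ℝ) (C X : Matrix (Fin n) (Fin n) ℝ)
    (hX : ∀ i j, X i j = B (Pi.single i 1) (Pi.single j 1)) (i j : Fin n) :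
    (Cᵀ * X * C) i j = B (fun k => C k i) (fun k => C k j) := by
  rw [bil_expand]
  simp only [Matrix.mul_apply, Matrix.transpose_apply, hX, Finset.sum_mul]
  rw [Finset.sum_comm]
  refine Finset.sum_congr rfl fun k _ => Finset.sum_congr rfl fun l _ => ?_
  ring

theorem frame_identities (hΩ : IsOpen Ω) (hf : ContDiffOn ℝ (⊤ : ℕ∞) f Ω)
    (hpos : ∀ x ∈ Ω, (Hess n f x).PosDef)
    (hric : ∀ x ∈ Ω, ∀ i j : Fin n,
      pder n i (pder n j (fun y => Real.log (Hess n f y).det)) x = 0)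
    {y : Fin n → ℝ} (hy : y ∈ Ω) (v : Fin n → ℝ) :
    ∃ b : Fin n → (Fin n → ℝ), ∃ A Q : Matrix (Fin n) (Fin n) ℝ,
      (∀ i j, D2 f y (b i) (b j) = if i = j then 1 else 0) ∧
      (∃ c : Fin n → ℝ, v = ∑ i, c i • b i) ∧
      (∀ i j, A i j = D3 f y v (b i) (b j)) ∧ (∀ i j, Q i j = D4 f y v v (b i) (b j)) ∧
      (∑ i, D4 f y v v (b i) (b i) = (A * A).trace) ∧
      (∑ i, D5 f y v v v (b i) (b i) - 3 * (A * Q).trace + 2 * (A * A * A).trace = 0) := by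
  obtain ⟨h, hh⟩ := ric_line hΩ hf hpos hric hy v
  obtain ⟨C, hC1, hC2, hC3⟩ := exists_frame hΩ hf hpos hy
  let e : Fin n → (Fin n → ℝ) := fun i => Pi.single i 1
  let N1 : ℝ → Matrix (Fin n) (Fin n) ℝ := fun t => Matrix.of fun i j => D3 f (y + t • v) v (e i) (e j)
  let N2 : ℝ → Matrix (Fin n) (Fin n) ℝ := fun t => Matrix.of fun i j => D4 f (y + t • v) v v (e i) (e j)
  let N3 : Matrix (Fin n) (Fin n) ℝ := Matrix.of fun i j => D5 f y v v v (e i) (e j)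
  have hev := line_mem hΩ hy v
  have key := logdet_identities (N := fun t => Hess n f (y + t • v)) (N1 := N1) (N2 := N2)
    (N3 := N3) (h := h) ?_ ?_ ?_ ?_ hh
  rotate_left
  · filter_upwards [hev] with t ht using (hpos _ ht).det_pos
  · filter_upwards [hev.eventually_nhds] with t ht i j
    have h1 := hasDerivAt_line (hasFDerivAt_ap (hasFDerivAt_ap (D2h hΩ hf ht.self_of_nhds) (e i)) (e j))
      (line_hasDeriv y v t)
    refine (h1.congr_of_eventuallyEq ?_)
    filter_upwards [ht] with s hs using Hess_apply hΩ hf hs i j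
  · filter_upwards [hev] with t ht i j
    exact hasDerivAt_line (hasFDerivAt_ap (hasFDerivAt_ap (hasFDerivAt_ap (D3h hΩ hf ht) v) (e i)) (e j))
      (line_hasDeriv y v t)
  · intro i j
    have := hasDerivAt_line (γ := fun t : ℝ => y + t • v) (t := 0) (hasFDerivAt_ap (hasFDerivAt_ap (hasFDerivAt_ap (hasFDerivAt_ap (D4h hΩ hf 
      (hev.self_of_nhds)) v) v) (e i)) (e j))
      (line_hasDeriv y v 0)
    simp only [zero_smul, add_zero, ContinuousLinearMap.flip_apply] at this
    exact this
  simp only [zero_smul, add_zero, hC1] at key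
  have c0 : ∀ X : Matrix (Fin n) (Fin n) ℝ, (C * Cᵀ * X).trace = (Cᵀ * X * C).trace := by
    intro X; rw [Matrix.mul_assoc, Matrix.trace_mul_comm]
  have c1 : ∀ X Y : Matrix (Fin n) (Fin n) ℝ, (C * Cᵀ * X * (C * Cᵀ) * Y).trace =
      ((Cᵀ * X * C) * (Cᵀ * Y * C)).trace := by
    intro X Y
    have : C * Cᵀ * X * (C * Cᵀ) * Y = C * ((Cᵀ * X * C) * (Cᵀ * Y)) := by
      simp only [Matrix.mul_assoc]
    rw [this, Matrix.trace_mul_comm]; simp only [Matrix.mul_assoc]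
  have c2 : ∀ X Y Z : Matrix (Fin n) (Fin n) ℝ,
      (C * Cᵀ * X * (C * Cᵀ) * Y * (C * Cᵀ) * Z).trace =
      ((Cᵀ * X * C) * (Cᵀ * Y * C) * (Cᵀ * Z * C)).trace := by
    intro X Y Z
    have : C * Cᵀ * X * (C * Cᵀ) * Y * (C * Cᵀ) * Z =
      C * ((Cᵀ * X * C) * (Cᵀ * Y * C) * (Cᵀ * Z)) := by
      simp only [Matrix.mul_assoc]
    rw [this, Matrix.trace_mul_comm]; simp only [Matrix.mul_assoc]
  rw [c0, c1, c0, c1, c2] at key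
  refine ⟨fun i k => C k i, Cᵀ * N1 0 * C, Cᵀ * N2 0 * C, ?_, ?_, ?_, ?_, ?_, ?_⟩
  · intro i j
    rw [← conj_apply (D2 f y) C (Hess n f y) (Hess_apply hΩ hf hy), hC2, Matrix.one_apply]
  · refine ⟨C⁻¹ *ᵥ v, ?_⟩
    have : v = C *ᵥ (C⁻¹ *ᵥ v) := by rw [Matrix.mulVec_mulVec, hC3, Matrix.one_mulVec]
    conv_lhs => rw [this]
    ext k
    simp only [Matrix.mulVec, dotProduct, Finset.sum_apply, Pi.smul_apply, smul_eq_mul]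
    exact Finset.sum_congr rfl fun i _ => mul_comm _ _
  · intro i j
    exact conj_apply (D3 f y v) C _ (fun i j => by simp [N1, e]) i j
  · intro i j
    exact conj_apply (D4 f y v v) C _ (fun i j => by simp [N2, e]) i j
  · rw [← key.1]
    simp only [Matrix.trace, Matrix.diag]
    refine Finset.sum_congr rfl fun i _ => ?_
    exact (conj_apply (D4 f y v v) C _ (fun i j => by simp [N2, e]) i i).symm
  · have : ∑ i, D5 f y v v v (fun k => C k i) (fun k => C k i) = (Cᵀ * N3 * C).trace := by
      simp only [Matrix.trace, Matrix.diag]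
      refine Finset.sum_congr rfl fun i _ => ?_
      exact (conj_apply (D5 f y v v v) C _ (fun i j => by simp [N3, e]) i i).symm
    rw [this]; exact key.2
end hess
end piecec

section pieced
open Matrix Set Filter Topology
open scoped ContDiff
set_option synthInstance.maxHeartbeats 400000
set_option synthInstance.maxSize 1000
set_option maxHeartbeats 1000000
set_option maxSynthPendingDepth 10
set_option linter.unusedVariables false

section curves
variable {E : Type*} [NormedAddCommGroup E] [NormedSpace ℝ E] {Ω : Set E} {f : E → ℝ}

theorem ln_hd (y v : E) (t : ℝ) : HasDerivAt (fun t : ℝ => y + t • v) v t := by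
  simpa using ((hasDerivAt_id t).smul_const v).const_add y

theorem der_s (hΩ : IsOpen Ω) (hf : ContDiffOn ℝ (⊤ : ℕ∞) f Ω) {y e v η : E} {t : ℝ}
    (ht : y + t • e ∈ Ω) :
    HasDerivAt (fun t : ℝ => D2 f (y + t • e) (v + t • η) (v + t • η))
      (D3 f (y + t • e) e (v + t • η) (v + t • η) + 2 * D2 f (y + t • e) η (v + t • η)) t := by
  have h := ((hasDerivAt_line (D2h hΩ hf ht) (ln_hd y e t)).clm_apply (ln_hd v η t)).clm_apply
    (ln_hd v η t)
  refine h.congr_deriv ?_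
  simp only [_root_.add_apply]
  rw [D2_symm hΩ hf ht (v + t • η) η]; ring

theorem der_s' (hΩ : IsOpen Ω) (hf : ContDiffOn ℝ (⊤ : ℕ∞) f Ω) {y e v η : E} {t : ℝ}
    (ht : y + t • e ∈ Ω) :
    HasDerivAt (fun t : ℝ => D3 f (y + t • e) e (v + t • η) (v + t • η) + 2 * D2 f (y + t • e) η (v + t • η))
      (D4 f (y + t • e) e e (v + t • η) (v + t • η) + 4 * D3 f (y + t • e) e η (v + t • η)
        + 2 * D2 f (y + t • e) η η) t := by
  have h1 := (((hasDerivAt_line (D3h hΩ hf ht) (ln_hd y e t)).clm_apply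
    (hasDerivAt_const t e)).clm_apply (ln_hd v η t)).clm_apply (ln_hd v η t)
  have h2 := ((hasDerivAt_line (D2h hΩ hf ht) (ln_hd y e t)).clm_apply
    (hasDerivAt_const t η)).clm_apply (ln_hd v η t)
  refine (h1.add (h2.const_mul 2)).congr_deriv ?_
  simp only [_root_.add_apply, map_zero, add_zero]
  rw [D3_symm23 hΩ hf ht e (v + t • η) η]; ring

theorem der_p (hΩ : IsOpen Ω) (hf : ContDiffOn ℝ (⊤ : ℕ∞) f Ω) {y e v η : E} {t : ℝ}
    (ht : y + t • e ∈ Ω) :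
    HasDerivAt (fun t : ℝ => D3 f (y + t • e) (v + t • η) (v + t • η) (v + t • η))
      (D4 f (y + t • e) e (v + t • η) (v + t • η) (v + t • η)
        + 3 * D3 f (y + t • e) η (v + t • η) (v + t • η)) t := by
  have h := (((hasDerivAt_line (D3h hΩ hf ht) (ln_hd y e t)).clm_apply (ln_hd v η t)).clm_apply
    (ln_hd v η t)).clm_apply (ln_hd v η t)
  refine h.congr_deriv ?_
  simp only [_root_.add_apply]
  rw [D3_symm23 hΩ hf ht (v + t • η) (v + t • η) η, D3_symm12 hΩ hf ht (v + t • η) η]; ring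

theorem der_p' (hΩ : IsOpen Ω) (hf : ContDiffOn ℝ (⊤ : ℕ∞) f Ω) {y e v η : E} {t : ℝ}
    (ht : y + t • e ∈ Ω) :
    HasDerivAt (fun t : ℝ => D4 f (y + t • e) e (v + t • η) (v + t • η) (v + t • η)
        + 3 * D3 f (y + t • e) η (v + t • η) (v + t • η))
      (D5 f (y + t • e) e e (v + t • η) (v + t • η) (v + t • η)
        + 6 * D4 f (y + t • e) e η (v + t • η) (v + t • η)
        + 6 * D3 f (y + t • e) η η (v + t • η)) t := by
  have h1 := ((((hasDerivAt_line (D4h hΩ hf ht) (ln_hd y e t)).clm_apply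
    (hasDerivAt_const t e)).clm_apply (ln_hd v η t)).clm_apply
    (ln_hd v η t)).clm_apply (ln_hd v η t)
  have h2 := (((hasDerivAt_line (D3h hΩ hf ht) (ln_hd y e t)).clm_apply
    (hasDerivAt_const t η)).clm_apply (ln_hd v η t)).clm_apply (ln_hd v η t)
  refine (h1.add (h2.const_mul 3)).congr_deriv ?_
  simp only [_root_.add_apply, map_zero, add_zero]
  rw [D4_symm34 hΩ hf ht e (v + t • η) (v + t • η) η, D4_symm23 hΩ hf ht e (v + t • η) η,
    D3_symm23 hΩ hf ht η (v + t • η) η]; ring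

theorem D2_expand (hΩ : IsOpen Ω) (hf : ContDiffOn ℝ (⊤ : ℕ∞) f Ω) {x : E} (hx : x ∈ Ω) (v w : E)
    (t : ℝ) : D2 f x (v + t • w) (v + t • w) =
      D2 f x v v + 2 * t * D2 f x v w + t ^ 2 * D2 f x w w := by
  simp only [map_add, map_smul, _root_.add_apply, _root_.smul_apply, smul_eq_mul]
  rw [D2_symm hΩ hf hx w v]; ring

theorem D3_expand (hΩ : IsOpen Ω) (hf : ContDiffOn ℝ (⊤ : ℕ∞) f Ω) {x : E} (hx : x ∈ Ω) (v w : E)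
    (t : ℝ) : D3 f x (v + t • w) (v + t • w) (v + t • w) =
      D3 f x v v v + 3 * t * D3 f x v v w + 3 * t ^ 2 * D3 f x v w w + t ^ 3 * D3 f x w w w := by
  simp only [map_add, map_smul, _root_.add_apply, _root_.smul_apply, smul_eq_mul]
  rw [D3_symm23 hΩ hf hx w w v, D3_symm12 hΩ hf hx w v w, D3_symm23 hΩ hf hx v w v,
    D3_symm12 hΩ hf hx w v v, D3_symm23 hΩ hf hx v w v]; ring

theorem key_second (hΩ : IsOpen Ω) (hf : ContDiffOn ℝ (⊤ : ℕ∞) f Ω) {y v e η : E} (hy : y ∈ Ω)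
    {τ K : ℝ} (l : E →L[ℝ] ℝ) (hv : D2 f y v v = 1) (hτ : D3 f y v v v = τ)
    (hmax : ∀ᶠ x in 𝓝 y, ∀ w, 2 * D3 f x w w w ≤
      (τ + K * (f x - f y - l (x - y))) * (D2 f x w w + (D2 f x w w) ^ 2))
    (hs' : D3 f y e v v + 2 * D2 f y η v = 0) :
    2 * (D5 f y e e v v v + 6 * D4 f y e η v v + 6 * D3 f y η η v) ≤
      2 * (K * D2 f y e e) +
        3 * τ * (D4 f y e e v v + 4 * D3 f y e η v + 2 * D2 f y η η) := by
  have hcont : Tendsto (fun t : ℝ => y + t • e) (𝓝 0) (𝓝 y) := by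
    have : Tendsto (fun t : ℝ => y + t • e) (𝓝 0) (𝓝 (y + (0 : ℝ) • e)) :=
      Continuous.tendsto (by fun_prop) 0
    simpa using this
  have hev : ∀ᶠ t in 𝓝 (0 : ℝ), y + t • e ∈ Ω := hcont (hΩ.mem_nhds hy)
  have hy0 : y + (0 : ℝ) • e ∈ Ω := by simpa using hy
  have hc : ∀ t : ℝ, y + t • e ∈ Ω → HasDerivAt
      (fun t : ℝ => τ + K * (f (y + t • e) - f y - l (y + t • e - y)))
      (K * (fderiv ℝ f (y + t • e) e - l e)) t := by
    intro t ht
    have h1 := hasDerivAt_line (smooth_hasFDerivAt hΩ hf ht) (ln_hd y e t)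
    have h2 : HasDerivAt (fun t : ℝ => l (y + t • e - y)) (l e) t := by
      have : HasDerivAt (fun t : ℝ => t * l e) (l e) t := by
        simpa using (hasDerivAt_id t).mul_const (l e)
      refine this.congr_of_eventuallyEq (Eventually.of_forall fun s => ?_)
      simp
    exact (((h1.sub_const _).sub h2).const_mul K).const_add τ
  have hc' : HasDerivAt (fun t : ℝ => K * (fderiv ℝ f (y + t • e) e - l e)) (K * D2 f y e e) 0 := by
    have h1 := (hasDerivAt_line (D1h hΩ hf hy0) (ln_hd y e 0)).clm_apply (hasDerivAt_const 0 e)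
    have := ((h1.sub_const (l e)).const_mul K)
    simpa using this
  have hG : ∀ t : ℝ, y + t • e ∈ Ω → HasDerivAt _ _ t := fun t ht =>
    ((der_p hΩ hf (v := v) (η := η) ht).const_mul 2).sub
      ((hc t ht).mul ((der_s hΩ hf (v := v) (η := η) ht).add
        ((der_s hΩ hf (v := v) (η := η) ht).mul (der_s hΩ hf (v := v) (η := η) ht))))
  have hs := der_s hΩ hf (v := v) (η := η) hy0
  have hss := der_s' hΩ hf (v := v) (η := η) hy0
  have hpp := der_p' hΩ hf (v := v) (η := η) hy0
  have hc0 := hc 0 hy0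
  have hG' := (hpp.const_mul 2).sub ((hc'.mul (hs.add (hs.mul hs))).add
    (hc0.mul (hss.add ((hss.mul hs).add (hs.mul hss)))))
  have := second_deriv_test (hev.mono hG) hG' ?_
  · simp only [zero_smul, add_zero, Pi.mul_apply, Pi.add_apply, hv, hτ, hs', sub_self, map_zero, mul_zero, sub_zero] at this
    linarith
  · filter_upwards [hcont.eventually hmax] with t ht
    have := ht (v + t • η)
    simp only [zero_smul, add_zero, Pi.mul_apply, Pi.add_apply, Pi.sub_apply, hv, hτ, hs', sub_self, map_zero, mul_zero, sub_zero]
    nlinarith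

theorem D3vww_le (hΩ : IsOpen Ω) (hf : ContDiffOn ℝ (⊤ : ℕ∞) f Ω) {y v : E} (hy : y ∈ Ω)
    {τ : ℝ} (hτ0 : 0 < τ) (hv : D2 f y v v = 1) (hτ : D3 f y v v v = τ)
    (hp : ∀ w, 0 ≤ D2 f y w w)
    (H : ∀ w, 2 * D3 f y w w w ≤ τ * (D2 f y w w + (D2 f y w w) ^ 2)) (w : E) :
    D3 f y v w w ≤ 7 / 6 * τ * D2 f y w w := by
  set m := D2 f y w w
  set d := D2 f y v w
  have hdm : d ^ 2 ≤ m := by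
    have := hp (w + (-d) • v)
    rw [D2_expand hΩ hf hy, hv, D2_symm hΩ hf hy w v] at this
    nlinarith
  have h1 : ∀ t : ℝ, 0 < t → 6 * D3 f y v w w ≤ τ * (3 * m + 4 * d ^ 2) + t ^ 2 * (τ * m ^ 2) := by
    intro t ht
    have a1 := H (v + t • w)
    have a2 := H (v + (-t) • w)
    rw [D2_expand hΩ hf hy, D3_expand hΩ hf hy, hv, hτ] at a1 a2
    have : t ^ 2 * (6 * D3 f y v w w) ≤ t ^ 2 * (τ * (3 * m + 4 * d ^ 2) + t ^ 2 * (τ * m ^ 2)) := by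
      linarith
    exact le_of_mul_le_mul_left this (by positivity)
  have h2 : 6 * D3 f y v w w ≤ τ * (3 * m + 4 * d ^ 2) := by
    have ht : Tendsto (fun t : ℝ => τ * (3 * m + 4 * d ^ 2) + t ^ 2 * (τ * m ^ 2)) (𝓝[>] 0)
        (𝓝 (τ * (3 * m + 4 * d ^ 2) + 0 ^ 2 * (τ * m ^ 2))) :=
      (Continuous.tendsto (by fun_prop) 0).mono_left nhdsWithin_le_nhds
    have := ge_of_tendsto ht (by filter_upwards [self_mem_nhdsWithin] with t ht using h1 t ht)
    simpa using this
  nlinarith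
end curves

section lemD
variable {n : ℕ} {Ω : Set (Fin n → ℝ)} {f : (Fin n → ℝ) → ℝ}

theorem lemma_D (hΩ : IsOpen Ω) (hf : ContDiffOn ℝ (⊤ : ℕ∞) f Ω)
    (hpos : ∀ x ∈ Ω, (Hess n f x).PosDef)
    (hric : ∀ x ∈ Ω, ∀ i j : Fin n,
      pder n i (pder n j (fun y => Real.log (Hess n f y).det)) x = 0)
    {y v : Fin n → ℝ} (hy : y ∈ Ω) {τ K : ℝ} (hτ0 : 0 < τ) (l : (Fin n → ℝ) →L[ℝ] ℝ)
    (hv : D2 f y v v = 1) (hτ : D3 f y v v v = τ)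
    (hmax : ∀ᶠ x in 𝓝 y, ∀ w, 2 * D3 f x w w w ≤
      (τ + K * (f x - f y - l (x - y))) * (D2 f x w w + (D2 f x w w) ^ 2)) :
    τ ^ 3 ≤ 6 * K * n := by
  obtain ⟨b, A, Q, hb, ⟨c, hc⟩, hA, hQ, h4, h5⟩ := frame_identities hΩ hf hpos hric hy v
  have hp : ∀ w, 0 ≤ D2 f y w w := fun w => by
    by_cases hw : w = 0
    · simp [hw]
    · exact (D2_pos hΩ hf hpos hy hw).le
  have H : ∀ w, 2 * D3 f y w w w ≤ τ * (D2 f y w w + (D2 f y w w) ^ 2) := fun w => by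
    simpa using hmax.self_of_nhds w
  have hle := D3vww_le hΩ hf hy hτ0 hv hτ hp H
  have hAs : ∀ i j, A i j = A j i := fun i j => by rw [hA, hA, D3_symm23 hΩ hf hy]
  have hQs : ∀ i j, Q i j = Q j i := fun i j => by rw [hQ, hQ, D4_symm34 hΩ hf hy]
  let u : Fin n → (Fin n → ℝ) := fun i => ∑ j, A i j • b j
  let a : Fin n → ℝ := fun i => ∑ j, A i j ^ 2
  have hlin : ∀ (L : (Fin n → ℝ) →L[ℝ] ℝ) i, L (u i) = ∑ j, A i j * L (b j) := by
    intro L i; simp [u, map_sum]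
  have hbu : ∀ i j, D2 f y (b j) (u i) = A i j := by
    intro i j; rw [hlin]; simp [hb]
  have huu : ∀ i, D2 f y (u i) (u i) = a i := by
    intro i
    rw [hlin]
    refine Finset.sum_congr rfl fun j _ => ?_
    rw [D2_symm hΩ hf hy, hbu]; ring
  have hvb : ∀ j, D2 f y (b j) v = c j := by
    intro j; rw [hc, map_sum]; simp [hb]
  have huv : ∀ i, D2 f y (u i) v = ∑ j, A i j * c j := by
    intro i; rw [D2_symm hΩ hf hy, hlin]
    refine Finset.sum_congr rfl fun j _ => ?_
    rw [D2_symm hΩ hf hy, hvb]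
  have hlv : ∀ (L : (Fin n → ℝ) →L[ℝ] ℝ), L v = ∑ j, c j * L (b j) := by
    intro L; conv_lhs => rw [hc]
    simp [map_sum]
  have h3bv : ∀ i, D3 f y (b i) v v = ∑ j, A i j * c j := by
    intro i
    rw [D3_symm12 hΩ hf hy, hlv]
    refine Finset.sum_congr rfl fun j _ => ?_
    rw [hA]; ring
  have hcc : ∑ i, c i ^ 2 = 1 := by
    rw [← hv, hlv]
    refine Finset.sum_congr rfl fun j _ => ?_
    rw [D2_symm hΩ hf hy, hvb]; ring
  have hτs : τ = ∑ i, c i * ∑ j, A i j * c j := by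
    rw [← hτ, hlv]
    refine Finset.sum_congr rfl fun j _ => ?_
    rw [D3_symm23 hΩ hf hy, D3_symm12 hΩ hf hy, h3bv]
  have hsq : τ ^ 2 ≤ ∑ i, a i := by
    calc τ ^ 2 = (∑ i, c i * ∑ j, A i j * c j) ^ 2 := by rw [← hτs]
      _ ≤ (∑ i, c i ^ 2) * ∑ i, (∑ j, A i j * c j) ^ 2 := Finset.sum_mul_sq_le_sq_mul_sq _ _ _
      _ ≤ ∑ i, a i := by
        rw [hcc, one_mul]
        refine Finset.sum_le_sum fun i _ => ?_
        have := Finset.sum_mul_sq_le_sq_mul_sq Finset.univ (fun j => A i j) c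
        rwa [hcc, mul_one] at this
  have hbuv : ∀ i, D3 f y (b i) (u i) v = a i := by
    intro i
    rw [D3_symm23 hΩ hf hy, D3_symm12 hΩ hf hy, hlin]
    refine Finset.sum_congr rfl fun j _ => ?_
    rw [← hA]; ring
  have h4u : ∀ i, D4 f y (b i) (u i) v v = ∑ j, A i j * Q i j := by
    intro i
    rw [← D4_swap hΩ hf hy, hlin]
    refine Finset.sum_congr rfl fun j _ => ?_
    rw [← hQ]
  have hkey : ∀ i, 2 * (D5 f y v v v (b i) (b i) - 3 * (∑ j, A i j * Q i j)
      + 3 / 2 * D3 f y v (u i) (u i)) ≤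
      2 * K + 3 * τ * (D4 f y v v (b i) (b i) - 3 / 2 * a i) := by
    intro i
    have := key_second hΩ hf (e := b i) (η := (-(1/2) : ℝ) • u i) hy l hv hτ hmax (by
      rw [h3bv, map_smul, _root_.smul_apply, huv, smul_eq_mul]; ring)
    simp only [map_smul, _root_.smul_apply, smul_eq_mul] at this
    rw [h4u, hbuv, huu, ← D5_swap hΩ hf hy, ← D4_swap hΩ hf hy, hb, if_pos rfl,
      D3_symm23 hΩ hf hy, D3_symm12 hΩ hf hy] at this
    linarith
  have hsum := Finset.sum_le_sum (fun i (_ : i ∈ Finset.univ) => hkey i)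
  have t2 : (A * A).trace = ∑ i, a i := by
    simp only [Matrix.trace, Matrix.diag, Matrix.mul_apply, a]
    refine Finset.sum_congr rfl fun i _ => Finset.sum_congr rfl fun j _ => ?_
    rw [hAs j i]; ring
  have tq : (A * Q).trace = ∑ i, ∑ j, A i j * Q i j := by
    simp only [Matrix.trace, Matrix.diag, Matrix.mul_apply]
    refine Finset.sum_congr rfl fun i _ => Finset.sum_congr rfl fun j _ => ?_
    rw [hQs j i]
  have t3 : (A * A * A).trace = ∑ i, D3 f y v (u i) (u i) := by
    simp only [Matrix.trace, Matrix.diag, Matrix.mul_apply]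
    refine Finset.sum_congr rfl fun i _ => ?_
    rw [hlin]
    refine Finset.sum_congr rfl fun k _ => ?_
    rw [D3_symm23 hΩ hf hy, hlin, mul_comm, hAs k i]
    congr 1
    refine Finset.sum_congr rfl fun j _ => ?_
    rw [D3_symm23 hΩ hf hy, ← hA]
  have hle' : ∑ i, D3 f y v (u i) (u i) ≤ 7 / 6 * τ * ∑ i, a i := by
    rw [Finset.mul_sum]
    refine Finset.sum_le_sum fun i _ => ?_
    rw [← huu]; exact hle _
  rw [← Finset.mul_sum] at hsum
  simp only [Finset.sum_add_distrib, Finset.sum_sub_distrib, ← Finset.mul_sum, Finset.sum_const,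
    Finset.card_univ, Fintype.card_fin, nsmul_eq_mul] at hsum
  rw [← tq, ← t3, h4, ← t2] at hsum
  rw [← t3, ← t2] at hle'
  rw [← t2] at hsq
  have : τ * τ ^ 2 ≤ τ * (A * A).trace := mul_le_mul_of_nonneg_left hsq hτ0.le
  nlinarith
end lemD
end pieced

section piecee
open Matrix Set Filter Topology
open scoped ContDiff
set_option synthInstance.maxHeartbeats 400000
set_option synthInstance.maxSize 1000
set_option maxHeartbeats 1000000
set_option maxSynthPendingDepth 10
set_option linter.unusedVariables false

noncomputable def Wf {n : ℕ} (f : (Fin n → ℝ) → ℝ) (x v : Fin n → ℝ) : ℝ :=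
  D3 f x v v v / (D2 f x v v * √(D2 f x v v))

def Sph (n : ℕ) : Set (Fin n → ℝ) := Metric.sphere 0 1

noncomputable def Tf {n : ℕ} (f : (Fin n → ℝ) → ℝ) (x : Fin n → ℝ) : ℝ :=
  sSup (Wf f x '' Sph n)

section T
variable {n : ℕ} {Ω : Set (Fin n → ℝ)} {f : (Fin n → ℝ) → ℝ}

theorem Sph_compact : IsCompact (Sph n) := isCompact_sphere 0 1

theorem Sph_ne {v : Fin n → ℝ} (hv : v ∈ Sph n) : v ≠ 0 := by
  rintro rfl
  simp [Sph] at hv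

theorem Sph_nonempty (hn : 1 ≤ n) : (Sph n).Nonempty := by
  have : Nonempty (Fin n) := ⟨⟨0, hn⟩⟩
  have : Nontrivial (Fin n → ℝ) := inferInstance
  exact NormedSpace.sphere_nonempty.2 zero_le_one

theorem Sph_norm {v : Fin n → ℝ} (hv : v ≠ 0) : ‖v‖⁻¹ • v ∈ Sph n := by
  simp [Sph, norm_smul, hv]

theorem D2_cont (hΩ : IsOpen Ω) (hf : ContDiffOn ℝ (⊤ : ℕ∞) f Ω) :
    ContinuousOn (fun p : (Fin n → ℝ) × (Fin n → ℝ) => D2 f p.1 p.2 p.2) (Ω ×ˢ univ) := by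
  have h := (D2s hΩ hf).continuousOn.comp (continuous_fst.continuousOn (s := Ω ×ˢ (univ : Set (Fin n → ℝ))))
    (fun p hp => hp.1)
  exact (h.clm_apply continuousOn_snd).clm_apply continuousOn_snd

theorem D3_cont (hΩ : IsOpen Ω) (hf : ContDiffOn ℝ (⊤ : ℕ∞) f Ω) :
    ContinuousOn (fun p : (Fin n → ℝ) × (Fin n → ℝ) => D3 f p.1 p.2 p.2 p.2) (Ω ×ˢ univ) := by
  have h := (D3s hΩ hf).continuousOn.comp (continuous_fst.continuousOn (s := Ω ×ˢ (univ : Set (Fin n → ℝ))))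
    (fun p hp => hp.1)
  exact ((h.clm_apply continuousOn_snd).clm_apply continuousOn_snd).clm_apply continuousOn_snd

set_option linter.unusedSectionVars false
variable (hΩ : IsOpen Ω) (hf : ContDiffOn ℝ (⊤ : ℕ∞) f Ω) (hpos : ∀ x ∈ Ω, (Hess n f x).PosDef)
include hΩ hf hpos

theorem W_cont : ContinuousOn (fun p : (Fin n → ℝ) × (Fin n → ℝ) => Wf f p.1 p.2) (Ω ×ˢ Sph n) := by
  have h2 := (D2_cont hΩ hf).mono (prod_mono_right (subset_univ (Sph n)))
  have h3 := (D3_cont hΩ hf).mono (prod_mono_right (subset_univ (Sph n)))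
  refine h3.div (h2.mul h2.sqrt) ?_
  rintro ⟨x, v⟩ ⟨hx, hv⟩
  have := D2_pos hΩ hf hpos hx (Sph_ne hv)
  exact (mul_pos this (Real.sqrt_pos.2 this)).ne'

theorem D2_nonneg {x : Fin n → ℝ} (hx : x ∈ Ω) (v : Fin n → ℝ) : 0 ≤ D2 f x v v := by
  by_cases hw : v = 0
  · simp [hw]
  · exact (D2_pos hΩ hf hpos hx hw).le

theorem W_smul {x v : Fin n → ℝ} (hx : x ∈ Ω) (hv : v ≠ 0) {c : ℝ} (hc : 0 < c) :
    Wf f x (c • v) = Wf f x v := by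
  have h := D2_pos hΩ hf hpos hx hv
  have h' := Real.sqrt_pos.2 h
  have e : D2 f x (c • v) (c • v) = c ^ 2 * D2 f x v v := by
    simp; ring
  unfold Wf
  rw [e, Real.sqrt_mul (by positivity), Real.sqrt_sq hc.le]
  simp only [map_smul, _root_.smul_apply, smul_eq_mul]
  rw [div_eq_div_iff (by positivity) (by positivity)]
  ring

theorem W_neg (x v : Fin n → ℝ) : Wf f x (-v) = - Wf f x v := by
  simp [Wf, neg_div]

theorem W_bdd {x : Fin n → ℝ} (hx : x ∈ Ω) : IsCompact (Wf f x '' Sph n) := by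
  refine Sph_compact.image_of_continuousOn ?_
  exact (W_cont hΩ hf hpos).comp (f := fun v => (x, v)) (by fun_prop) (fun v hv => ⟨hx, hv⟩)

theorem T_max (hn : 1 ≤ n) {x : Fin n → ℝ} (hx : x ∈ Ω) : ∃ v ∈ Sph n, Wf f x v = Tf f x :=
  (W_bdd hΩ hf hpos hx).sSup_mem ((Sph_nonempty hn).image _)

theorem W_le {x v : Fin n → ℝ} (hx : x ∈ Ω) (hv : v ≠ 0) : Wf f x v ≤ Tf f x := by
  rw [← W_smul hΩ hf hpos hx hv (c := ‖v‖⁻¹) (by positivity)]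
  exact le_csSup (W_bdd hΩ hf hpos hx).bddAbove (mem_image_of_mem _ (Sph_norm hv))

theorem T_nonneg (hn : 1 ≤ n) {x : Fin n → ℝ} (hx : x ∈ Ω) : 0 ≤ Tf f x := by
  obtain ⟨v, hv⟩ := Sph_nonempty hn
  have h1 := W_le hΩ hf hpos hx (Sph_ne hv)
  have h2 := W_le hΩ hf hpos hx (neg_ne_zero.2 (Sph_ne hv))
  rw [W_neg hΩ hf hpos] at h2
  linarith

theorem D3_le {x : Fin n → ℝ} (hx : x ∈ Ω) (v : Fin n → ℝ) :
    |D3 f x v v v| ≤ Tf f x * (D2 f x v v * √(D2 f x v v)) := by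
  by_cases hv : v = 0
  · simp [hv]
  have h := D2_pos hΩ hf hpos hx hv
  have h' := Real.sqrt_pos.2 h
  have h1 := W_le hΩ hf hpos hx hv
  have h2 := W_le hΩ hf hpos hx (neg_ne_zero.2 hv)
  rw [W_neg hΩ hf hpos] at h2
  unfold Wf at h1 h2
  rw [div_le_iff₀ (by positivity)] at h1
  rw [← neg_div, div_le_iff₀ (by positivity)] at h2
  rw [abs_le]; constructor <;> linarith

theorem T_cont : ContinuousOn (Tf f) Ω := by
  rw [continuousOn_iff_continuous_domRestrict]
  have : CompactSpace (Sph n) := isCompact_iff_compactSpace.1 Sph_compact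
  have := IsCompact.continuous_sSup (f := fun (x : Ω) (v : Sph n) => Wf f x v) (K := univ)
    isCompact_univ ?_
  · refine this.congr fun x => ?_
    simp only [domRestrict_apply, Tf, image_univ]
    congr 1
    ext r; simp
  · have := (W_cont hΩ hf hpos).comp_continuous
      (f := fun p : Ω × Sph n => ((p.1 : Fin n → ℝ), (p.2 : Fin n → ℝ))) (by fun_prop)
      (fun p => ⟨p.1.2, p.2.2⟩)
    exact this

end T
end piecee

section piecef
open Matrix Set Filter Topology
open scoped ContDiff
set_option linter.unusedVariables false
set_option linter.unusedSectionVars false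

section EX
variable {n : ℕ} {Ω : Set (Fin n → ℝ)} {f : (Fin n → ℝ) → ℝ}
variable (hΩ : IsOpen Ω) (hf : ContDiffOn ℝ (⊤ : ℕ∞) f Ω) (hpos : ∀ x ∈ Ω, (Hess n f x).PosDef)
include hΩ hf hpos

theorem lemma_E {x u : Fin n → ℝ} {c s : ℝ} (hc : 0 ≤ c) (hs : s ≤ 1)
    (hg : ∀ t ∈ Icc 0 s, x + t • u ∈ Ω ∧ Tf f (x + t • u) ≤ c)
    (hm : c ^ 2 * D2 f x u u ≤ 1) {t : ℝ} (ht : t ∈ Icc 0 s) :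
    D2 f x u u / 4 ≤ D2 f (x + t • u) u u ∧ D2 f (x + t • u) u u ≤ 4 * D2 f x u u := by
  by_cases hu : u = 0
  · simp [hu]
  have h0 : (0 : ℝ) ∈ Icc 0 s := ⟨le_rfl, ht.1.trans ht.2⟩
  have hP : ∀ t ∈ Icc 0 s, 0 < D2 f (x + t • u) u u := fun t ht => D2_pos hΩ hf hpos (hg t ht).1 hu
  have hd : ∀ t ∈ Icc 0 s, HasDerivWithinAt (fun t : ℝ => (√(D2 f (x + t • u) u u))⁻¹)
      (-(D3 f (x + t • u) u u u / (2 * √(D2 f (x + t • u) u u))) / (√(D2 f (x + t • u) u u)) ^ 2)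
      (Icc 0 s) t := by
    intro t ht
    have h1 := der_s hΩ hf (v := u) (η := 0) (hg t ht).1
    simp only [smul_zero, add_zero, map_zero, _root_.zero_apply, mul_zero] at h1
    exact ((h1.sqrt (hP t ht).ne').inv (Real.sqrt_pos.2 (hP t ht)).ne').hasDerivWithinAt
  have hb : ∀ t ∈ Icc 0 s, ‖-(D3 f (x + t • u) u u u / (2 * √(D2 f (x + t • u) u u))) /
      (√(D2 f (x + t • u) u u)) ^ 2‖ ≤ c / 2 := by
    intro t ht
    have h3 := D3_le hΩ hf hpos (hg t ht).1 u
    have hp := hP t ht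
    have hq := Real.sqrt_pos.2 hp
    set P := D2 f (x + t • u) u u
    rw [Real.norm_eq_abs, abs_div, abs_neg, abs_div, abs_of_pos (a := 2 * √P) (by positivity),
      abs_of_pos (a := √P ^ 2) (by positivity), div_div, div_le_iff₀ (by positivity)]
    have h4 : Tf f (x + t • u) * (P * √P) ≤ c * (P * √P) :=
      mul_le_mul_of_nonneg_right (hg t ht).2 (by positivity)
    have h5 : √P ^ 2 = P := Real.sq_sqrt hp.le
    calc _ ≤ c * (P * √P) := h3.trans h4
      _ = _ := by rw [h5]; ring
  have key := (convex_Icc 0 s).norm_image_sub_le_of_norm_hasDerivWithin_le hd hb h0 ht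
  simp only [zero_smul, add_zero, sub_zero, Real.norm_eq_abs] at key
  have hm0 : 0 < D2 f x u u := by simpa using hP 0 h0
  have hpt := hP t ht
  set m := D2 f x u u
  set P := D2 f (x + t • u) u u
  have hqm := Real.sqrt_pos.2 hm0
  have hqP := Real.sqrt_pos.2 hpt
  have e1 : √m ^ 2 = m := Real.sq_sqrt hm0.le
  have e2 : √P ^ 2 = P := Real.sq_sqrt hpt.le
  have hcm : c * √m ≤ 1 := by
    have : (c * √m) ^ 2 ≤ 1 ^ 2 := by rw [mul_pow, e1]; simpa using hm
    exact le_of_sq_le_sq this zero_le_one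
  rw [abs_of_nonneg ht.1] at key
  have ht1 : t ≤ 1 := ht.2.trans hs
  have k2 : c / 2 * t ≤ c / 2 := by nlinarith [ht.1]
  have k3 := abs_le.1 (key.trans k2)
  have f1 : (√P)⁻¹ * √P = 1 := inv_mul_cancel₀ hqP.ne'
  have f2 : (√m)⁻¹ * √m = 1 := inv_mul_cancel₀ hqm.ne'
  have g1 : √m - √P ≤ c / 2 * (√m * √P) := by
    have := mul_le_mul_of_nonneg_right k3.2 (mul_pos hqm hqP).le
    have e : ((√P)⁻¹ - (√m)⁻¹) * (√m * √P) = √m * ((√P)⁻¹ * √P) - √P * ((√m)⁻¹ * √m) := by ring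
    rw [e, f1, f2] at this; linarith
  have g2 : √P - √m ≤ c / 2 * (√m * √P) := by
    have := mul_le_mul_of_nonneg_right k3.1 (mul_pos hqm hqP).le
    have e : ((√P)⁻¹ - (√m)⁻¹) * (√m * √P) = √m * ((√P)⁻¹ * √P) - √P * ((√m)⁻¹ * √m) := by ring
    rw [e, f1, f2] at this; linarith
  have g3 : c / 2 * (√m * √P) ≤ √P / 2 := by nlinarith
  have l1 : √P ≤ 2 * √m := by linarith
  have l2 : √m ≤ 2 * √P := by linarith
  constructor <;> nlinarith

theorem complete_contra (hcomplete : CalabiComplete n Ω f) (γ : ℝ → (Fin n → ℝ))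
    (h1 : ContDiffOn ℝ 1 γ (Ico (0 : ℝ) 1)) (h2 : ∀ t ∈ Ico (0 : ℝ) 1, γ t ∈ Ω)
    (h3 : ∀ K : Set (Fin n → ℝ), K ⊆ Ω → IsCompact K →
      ∃ t₀, t₀ < 1 ∧ ∀ t, t₀ < t → t < 1 → γ t ∉ K) (C : ℝ)
    (h4 : ∀ t ∈ Ioo (0 : ℝ) 1, D2 f (γ t) (deriv γ t) (deriv γ t) ≤ C) : False := by
  have h := hcomplete γ h1 h2 h3
  have hle : ∫⁻ t in Ioo (0 : ℝ) 1, ENNReal.ofReal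
      (Real.sqrt ((Hess n f (γ t)).mulVec (deriv γ t) ⬝ᵥ deriv γ t)) ≤
      ∫⁻ t in Ioo (0 : ℝ) 1, ENNReal.ofReal (√C) := by
    refine MeasureTheory.setLIntegral_mono' measurableSet_Ioo fun t ht => ?_
    rw [Hess_quad hΩ hf (h2 t (Ioo_subset_Ico_self ht))]
    exact ENNReal.ofReal_le_ofReal (Real.sqrt_le_sqrt (h4 t ht))
  rw [h] at hle
  simp at hle

theorem good_limit (hcomplete : CalabiComplete n Ω f) {x u : Fin n → ℝ} {c p : ℝ} (hc : 0 ≤ c)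
    (hp0 : 0 < p) (hp1 : p ≤ 1)
    (hg : ∀ t ∈ Ico 0 p, x + t • u ∈ Ω ∧ Tf f (x + t • u) ≤ c)
    (hm : c ^ 2 * D2 f x u u ≤ 1) : x + p • u ∈ Ω ∧ Tf f (x + p • u) ≤ c := by
  have hmem : x + p • u ∈ Ω := by
    by_contra hno
    refine complete_contra hΩ hf hpos hcomplete (fun t => x + t • (p • u)) ?_ ?_ ?_
      (4 * D2 f x u u) ?_
    · exact ContDiff.contDiffOn (by fun_prop)
    · intro t ht
      have := (hg (t * p) ⟨by have := ht.1; positivity, by nlinarith [ht.2]⟩).1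
      simpa [smul_smul] using this
    · intro K hK hKc
      have hx : x + (1 : ℝ) • (p • u) ∈ Kᶜ := by
        simp only [one_smul]; exact fun h => hno (hK h)
      have hcont : Continuous fun t : ℝ => x + t • (p • u) := by fun_prop
      have := hcont.continuousAt.preimage_mem_nhds (hKc.isClosed.isOpen_compl.mem_nhds hx)
      obtain ⟨ε, hε, hb⟩ := Metric.mem_nhds_iff.1 this
      refine ⟨1 - ε, by linarith, fun t h1 h2 => ?_⟩
      exact hb (by rw [Metric.mem_ball, Real.dist_eq, abs_lt]; constructor <;> linarith)
    · intro t ht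
      rw [(ln_hd x (p • u) t).deriv]
      have h1 : t * p < p := by nlinarith [ht.2]
      have h0 : 0 ≤ t * p := by have := ht.1; positivity
      have := (lemma_E hΩ hf hpos hc (s := t * p) (h1.le.trans hp1)
        (fun r hr => hg r ⟨hr.1, hr.2.trans_lt h1⟩) hm (t := t * p) ⟨h0, le_rfl⟩).2
      have hn0 := D2_nonneg hΩ hf hpos (hg (t * p) ⟨h0, h1⟩).1 u
      simp only [smul_smul, map_smul, _root_.smul_apply, smul_eq_mul]
      have hpp : p * p ≤ 1 := by nlinarith
      nlinarith
  refine ⟨hmem, ?_⟩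
  have hcont : Tendsto (fun t : ℝ => x + t • u) (𝓝[<] p) (𝓝 (x + p • u)) :=
    (Continuous.tendsto (by fun_prop) p).mono_left nhdsWithin_le_nhds
  have hT := (((T_cont hΩ hf hpos).continuousAt (hΩ.mem_nhds hmem)).tendsto).comp hcont
  refine le_of_tendsto hT ?_
  filter_upwards [Ioo_mem_nhdsLT hp0] with t ht using (hg t ⟨ht.1.le, ht.2⟩).2

theorem exit_lemma (hcomplete : CalabiComplete n Ω f) {x u : Fin n → ℝ} {c : ℝ} (hc : 0 ≤ c)
    (hx : x ∈ Ω) (hT : Tf f x ≤ c) (hm : c ^ 2 * D2 f x u u ≤ 1) :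
    (∀ t ∈ Icc (0 : ℝ) 1, x + t • u ∈ Ω ∧ Tf f (x + t • u) ≤ c) ∨
    ∃ s ∈ Icc (0 : ℝ) 1, (∀ t ∈ Icc (0 : ℝ) s, x + t • u ∈ Ω ∧ Tf f (x + t • u) ≤ c) ∧
      Tf f (x + s • u) = c := by
  by_contra! hcon
  obtain ⟨hcon1, hcon⟩ := hcon
  let A : Set ℝ := {s | ∀ t ∈ Icc (0 : ℝ) s, x + t • u ∈ Ω ∧ Tf f (x + t • u) ≤ c}
  have h0 : (0 : ℝ) ∈ A := by
    intro t ht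
    have : t = 0 := le_antisymm ht.2 ht.1
    simpa [this] using ⟨hx, hT⟩
  have hsub : Icc (0 : ℝ) 1 ⊆ A := by
    refine IsClosed.Icc_subset_of_forall_mem_nhdsWithin ?_ h0 ?_
    · refine isClosed_of_closure_subset fun p hp => ?_
      have hpI : p ∈ Icc (0 : ℝ) 1 := isClosed_Icc.closure_subset_iff.2 inter_subset_right hp
      refine ⟨?_, hpI⟩
      rcases eq_or_lt_of_le hpI.1 with h | h
      · rw [← h]; exact h0
      have hlt : ∀ t ∈ Ico 0 p, x + t • u ∈ Ω ∧ Tf f (x + t • u) ≤ c := by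
        intro t ht
        obtain ⟨a, ha, hA, -⟩ := mem_closure_iff.1 hp (Ioi t) isOpen_Ioi ht.2
        exact hA t ⟨ht.1, le_of_lt ha⟩
      intro t ht
      rcases eq_or_lt_of_le ht.2 with h' | h'
      · rw [h']; exact good_limit hΩ hf hpos hcomplete hc h hpI.2 hlt hm
      · exact hlt t ⟨ht.1, h'⟩
    · rintro s ⟨hsA, hs⟩
      have hs1 := hsA s ⟨hs.1, le_rfl⟩
      have hlt : Tf f (x + s • u) < c := lt_of_le_of_ne hs1.2 (hcon s ⟨hs.1, hs.2.le⟩ hsA)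
      have hcont : Tendsto (fun t : ℝ => x + t • u) (𝓝 s) (𝓝 (x + s • u)) :=
        (Continuous.tendsto (by fun_prop) s)
      have e1 := hcont.eventually (hΩ.mem_nhds hs1.1)
      have e2 := (((T_cont hΩ hf hpos).continuousAt (hΩ.mem_nhds hs1.1)).tendsto.comp hcont).eventually
        (gt_mem_nhds hlt)
      obtain ⟨ε, hε, hb⟩ := Metric.eventually_nhds_iff.1 (e1.and e2)
      filter_upwards [Ioo_mem_nhdsGT (show s < s + ε by linarith)] with r hr t ht
      by_cases hts : t ≤ s
      · exact hsA t ⟨ht.1, hts⟩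
      · push Not at hts
        have := hb (y := t) (by rw [Real.dist_eq, abs_lt]; constructor <;> linarith [ht.2, hr.2])
        exact ⟨this.1, this.2.le⟩
  obtain ⟨t, ht, h⟩ := hcon1
  have := hsub ht t ⟨ht.1, le_rfl⟩
  exact absurd this.2 (not_le.2 (h this.1))
end EX
end piecef

section pieceg
open Matrix Set Filter Topology
open scoped ContDiff
set_option linter.unusedVariables false
set_option linter.unusedSectionVars false

theorem st_deriv {x : ℝ} (hx : 1 ≤ x) : deriv Real.smoothTransition x = 0 := by
  refine IsLocalMax.deriv_eq_zero (Eventually.of_forall fun y => ?_)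
  rw [Real.smoothTransition.one_of_one_le hx]
  exact Real.smoothTransition.le_one y

theorem st_bound : ∃ M : ℝ, ∀ x ∈ Icc (0 : ℝ) 1, (deriv Real.smoothTransition x) ^ 2 ≤ M := by
  have hc : Continuous (deriv Real.smoothTransition) :=
    (Real.smoothTransition.contDiff (n := 1)).continuous_deriv le_rfl
  obtain ⟨M, hM⟩ := (isCompact_Icc (a := (0 : ℝ)) (b := 1)).bddAbove_image
    (f := fun x => (deriv Real.smoothTransition x) ^ 2) (by fun_prop)
  exact ⟨M, fun x hx => hM (mem_image_of_mem _ hx)⟩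

section CV
variable {n : ℕ} {Ω : Set (Fin n → ℝ)} {f : (Fin n → ℝ) → ℝ}

noncomputable def PN (X U : ℕ → (Fin n → ℝ)) (N : ℕ) (s : ℝ) : Fin n → ℝ :=
  X 0 + ∑ k ∈ Finset.range N, Real.smoothTransition (s - k) • U k

noncomputable def PP (X U : ℕ → (Fin n → ℝ)) (s : ℝ) : Fin n → ℝ :=
  X ⌊s⌋₊ + Real.smoothTransition (s - ⌊s⌋₊) • U ⌊s⌋₊

theorem X_sum {X U : ℕ → (Fin n → ℝ)} (hXU : ∀ k, X (k + 1) = X k + U k) (k : ℕ) :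
    X 0 + ∑ j ∈ Finset.range k, U j = X k := by
  induction k with
  | zero => simp
  | succ k ih => rw [Finset.sum_range_succ, ← add_assoc, ih, hXU]

theorem PP_eq {X U : ℕ → (Fin n → ℝ)} (hXU : ∀ k, X (k + 1) = X k + U k) {s : ℝ} (hs : 0 ≤ s)
    {N : ℕ} (hN : s < N) : PP X U s = PN X U N s := by
  have hk : ⌊s⌋₊ + 1 ≤ N := (Nat.floor_lt hs).2 hN
  have h1 : (⌊s⌋₊ : ℝ) ≤ s := Nat.floor_le hs
  have h2 : s < ⌊s⌋₊ + 1 := Nat.lt_floor_add_one s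
  have e1 : ∑ k ∈ Finset.range N, Real.smoothTransition (s - k) • U k =
      ∑ k ∈ Finset.range (⌊s⌋₊ + 1), Real.smoothTransition (s - k) • U k := by
    refine (Finset.sum_subset (Finset.range_mono hk) fun j _ hj => ?_).symm
    have : ⌊s⌋₊ + 1 ≤ j := by simpa using hj
    have : ((⌊s⌋₊ + 1 : ℕ) : ℝ) ≤ j := by exact_mod_cast this
    push_cast at this
    rw [Real.smoothTransition.zero_of_nonpos (by linarith), zero_smul]
  unfold PP PN
  rw [e1, Finset.sum_range_succ, ← add_assoc]
  congr 1
  rw [← X_sum hXU]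
  congr 1
  refine Finset.sum_congr rfl fun j hj => ?_
  have : j + 1 ≤ ⌊s⌋₊ := by simpa using hj
  have : ((j + 1 : ℕ) : ℝ) ≤ ⌊s⌋₊ := by exact_mod_cast this
  push_cast at this
  rw [Real.smoothTransition.one_of_one_le (by linarith), one_smul]

theorem PN_contDiff (X U : ℕ → (Fin n → ℝ)) (N : ℕ) : ContDiff ℝ 1 (PN X U N) := by
  unfold PN
  refine contDiff_const.add (ContDiff.sum fun k _ => ?_)
  exact ((Real.smoothTransition.contDiff (n := 1)).comp (contDiff_id.sub contDiff_const)).smul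
    contDiff_const

theorem PN_deriv (X U : ℕ → (Fin n → ℝ)) {s : ℝ} (hs : 0 ≤ s) :
    HasDerivAt (PN X U (⌊s⌋₊ + 1)) (deriv Real.smoothTransition (s - ⌊s⌋₊) • U ⌊s⌋₊) s := by
  have hσ : ∀ x, HasDerivAt Real.smoothTransition (deriv Real.smoothTransition x) x := fun x =>
    ((Real.smoothTransition.contDiff (n := 1)).differentiable one_ne_zero x).hasDerivAt
  have h : HasDerivAt (PN X U (⌊s⌋₊ + 1)) (∑ k ∈ Finset.range (⌊s⌋₊ + 1),
      deriv Real.smoothTransition (s - k) • U k) s := by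
    unfold PN
    refine HasDerivAt.const_add _ (HasDerivAt.fun_sum fun k _ => ?_)
    have h1 : HasDerivAt (fun s : ℝ => s - k) 1 s := (hasDerivAt_id s).sub_const _
    have := (hσ (s - k)).comp s h1
    rw [mul_one] at this
    exact this.smul_const (U k)
  refine h.congr_deriv ?_
  rw [Finset.sum_range_succ, Finset.sum_eq_zero, zero_add]
  intro j hj
  have : j + 1 ≤ ⌊s⌋₊ := by simpa using hj
  have : ((j + 1 : ℕ) : ℝ) ≤ ⌊s⌋₊ := by exact_mod_cast this
  push_cast at this
  have h1 : (⌊s⌋₊ : ℝ) ≤ s := Nat.floor_le hs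
  rw [st_deriv (by linarith), zero_smul]

variable (hΩ : IsOpen Ω) (hf : ContDiffOn ℝ (⊤ : ℕ∞) f Ω) (hpos : ∀ x ∈ Ω, (Hess n f x).PosDef)
include hΩ hf hpos

theorem lower_bound {K : Set (Fin n → ℝ)} (hK : IsCompact K) (hKΩ : K ⊆ Ω) :
    ∃ l : ℝ, 0 < l ∧ ∀ y ∈ K, ∀ w, l * ‖w‖ ^ 2 ≤ D2 f y w w := by
  have hcomp : ∃ l : ℝ, 0 < l ∧ ∀ p ∈ K ×ˢ Sph n, l ≤ D2 f p.1 p.2 p.2 := by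
    rcases (K ×ˢ Sph n).eq_empty_or_nonempty with h | h
    · exact ⟨1, one_pos, by simp [h]⟩
    · obtain ⟨p, hp, hmin⟩ := (hK.prod Sph_compact).exists_isMinOn h
        ((D2_cont hΩ hf).mono (prod_mono hKΩ (subset_univ _)))
      exact ⟨_, D2_pos hΩ hf hpos (hKΩ hp.1) (Sph_ne hp.2), fun q hq => hmin hq⟩
  obtain ⟨l, hl, h⟩ := hcomp
  refine ⟨l, hl, fun y hy w => ?_⟩
  by_cases hw : w = 0
  · simp [hw]
  have := h (y, ‖w‖⁻¹ • w) ⟨hy, Sph_norm hw⟩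
  have hw' : 0 < ‖w‖ := norm_pos_iff.2 hw
  simp only [map_smul, _root_.smul_apply, smul_eq_mul] at this
  calc l * ‖w‖ ^ 2 ≤ (‖w‖⁻¹ * (‖w‖⁻¹ * D2 f y w w)) * ‖w‖ ^ 2 :=
        mul_le_mul_of_nonneg_right this (by positivity)
    _ = D2 f y w w := by field_simp

theorem curve_contra (hcomplete : CalabiComplete n Ω f) (X U : ℕ → (Fin n → ℝ)) (m : ℕ → ℝ)
    (hXU : ∀ k, X (k + 1) = X k + U k)
    (hin : ∀ k, ∀ t ∈ Icc (0 : ℝ) 1, X k + t • U k ∈ Ω ∧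
      D2 f (X k + t • U k) (U k) (U k) ≤ 4 * m k)
    (B : ℝ) (hB : ∀ k : ℕ, ((k : ℝ) + 2) ^ 4 * m k ≤ B) (hm0 : Tendsto m atTop (𝓝 0))
    (hT : Tendsto (fun k => Tf f (X k)) atTop atTop) : False := by
  have hfl : ∀ s : ℝ, 0 ≤ s → Real.smoothTransition (s - ⌊s⌋₊) ∈ Icc (0 : ℝ) 1 := fun s _ =>
    ⟨Real.smoothTransition.nonneg _, Real.smoothTransition.le_one _⟩
  have hθ : ∀ t ∈ Ico (0 : ℝ) 1, 0 ≤ t / (1 - t) := fun t ht =>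
    div_nonneg ht.1 (by linarith [ht.2])
  have hθd : ∀ t : ℝ, t < 1 → HasDerivAt (fun t : ℝ => t / (1 - t)) (1 / (1 - t) ^ 2) t := by
    intro t ht
    have := (hasDerivAt_id t).div ((hasDerivAt_id t).const_sub 1) (by simp; linarith)
    refine this.congr_deriv ?_
    simp
  obtain ⟨M, hM⟩ := st_bound
  refine complete_contra hΩ hf hpos hcomplete (fun t => PP X U (t / (1 - t))) ?_ ?_ ?_
    (4 * M * B) ?_
  · intro t ht
    obtain ⟨N, hN⟩ := exists_nat_gt (t / (1 - t))
    have hc : ContinuousAt (fun t : ℝ => t / (1 - t)) t := (hθd t ht.2).continuousAt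
    have hev : ∀ᶠ r : ℝ in 𝓝 t, r / (1 - r) < (N : ℝ) := hc.eventually (gt_mem_nhds hN)
    have hsm : ContDiffAt ℝ 1 (fun t : ℝ => PN X U N (t / (1 - t))) t := by
      refine (PN_contDiff X U N).contDiffAt.comp t ?_
      exact contDiffAt_id.div (contDiffAt_const.sub contDiffAt_id) (by simp; linarith [ht.2])
    refine hsm.contDiffWithinAt.congr_of_eventuallyEq ?_ (PP_eq hXU (hθ t ht) hN)
    filter_upwards [self_mem_nhdsWithin, mem_nhdsWithin_of_mem_nhds hev] with r hr hr'
    exact PP_eq hXU (hθ r hr) hr'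
  · intro t ht
    exact (hin _ _ (hfl _ (hθ t ht))).1
  · intro K hK hKc
    have claim : ∃ N : ℕ, ∀ k ≥ N, ∀ r ∈ Icc (0 : ℝ) 1, X k + r • U k ∉ K := by
      obtain ⟨ρ, hρ, hρΩ⟩ := hKc.exists_cthickening_subset_open hΩ hK
      obtain ⟨M', hM'⟩ := (hKc.cthickening (r := ρ)).bddAbove_image
        ((T_cont hΩ hf hpos).mono hρΩ)
      obtain ⟨l, hl, hlow⟩ := lower_bound hΩ hf hpos hKc hK
      have e1 : ∀ᶠ k in atTop, m k < l * ρ ^ 2 / 4 := hm0.eventually (gt_mem_nhds (by positivity))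
      have e2 : ∀ᶠ k in atTop, M' < Tf f (X (k + 1)) :=
        (hT.comp (tendsto_add_atTop_nat 1)).eventually (eventually_gt_atTop M')
      obtain ⟨N, hN⟩ := eventually_atTop.1 (e1.and e2)
      refine ⟨N, fun k hk r hr hmem => ?_⟩
      have h1 := hlow _ hmem (U k)
      have h2 := (hin k r hr).2
      obtain ⟨h3, h4⟩ := hN k hk
      have hU : ‖U k‖ ≤ ρ := by
        have : l * ‖U k‖ ^ 2 ≤ l * ρ ^ 2 := by linarith
        exact le_of_sq_le_sq (le_of_mul_le_mul_left this hl) hρ.le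
      have hmem2 : X (k + 1) ∈ Metric.cthickening ρ K := by
        refine Metric.mem_cthickening_of_dist_le _ _ _ _ hmem ?_
        have : X (k + 1) - (X k + r • U k) = (1 - r) • U k := by
          rw [hXU, sub_smul, one_smul]; abel
        rw [dist_eq_norm, this, norm_smul, Real.norm_eq_abs, abs_of_nonneg (by linarith [hr.2])]
        nlinarith [norm_nonneg (U k), hr.1]
      exact absurd (hM' (mem_image_of_mem _ hmem2)) (not_le.2 h4)
    obtain ⟨N, hN⟩ := claim
    refine ⟨(N : ℝ) / (N + 1), by rw [div_lt_one (by positivity)]; linarith, fun t h1 h2 => ?_⟩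
    have h0 : 0 ≤ t := le_trans (by positivity) h1.le
    have hlt : (N : ℝ) ≤ t / (1 - t) := by
      rw [div_lt_iff₀ (by positivity)] at h1
      rw [le_div_iff₀ (by linarith)]
      linarith
    exact hN _ (Nat.le_floor hlt) _ (hfl _ (hθ t ⟨h0, h2⟩))
  · intro t ht
    have ht' : t ∈ Ico (0 : ℝ) 1 := ⟨ht.1.le, ht.2⟩
    have hs0 := hθ t ht'
    have hder : HasDerivAt (fun t => PP X U (t / (1 - t))) ((1 / (1 - t) ^ 2) •
        (deriv Real.smoothTransition (t / (1 - t) - ⌊t / (1 - t)⌋₊) • U ⌊t / (1 - t)⌋₊)) t := by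
      have h1 := (PN_deriv X U hs0).scomp t (hθd t ht.2)
      refine h1.congr_of_eventuallyEq ?_
      have hc : ContinuousAt (fun t : ℝ => t / (1 - t)) t := (hθd t ht.2).continuousAt
      have hev : ∀ᶠ r in 𝓝 t, r / (1 - r) < ((⌊t / (1 - t)⌋₊ + 1 : ℕ) : ℝ) :=
        hc.eventually (gt_mem_nhds (by push_cast; exact Nat.lt_floor_add_one _))
      filter_upwards [hev, Ioo_mem_nhds ht.1 ht.2] with r hr hr'
      exact PP_eq hXU (hθ r ⟨hr'.1.le, hr'.2⟩) hr
    rw [hder.deriv]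
    have hs1 : t / (1 - t) < ⌊t / (1 - t)⌋₊ + 1 := Nat.lt_floor_add_one _
    have hs2 : (⌊t / (1 - t)⌋₊ : ℝ) ≤ t / (1 - t) := Nat.floor_le hs0
    have hinv : 1 / (1 - t) = t / (1 - t) + 1 := by
      have : 1 - t ≠ 0 := by linarith [ht.2]
      field_simp; ring
    have hmain := hin ⌊t / (1 - t)⌋₊ _ (hfl _ hs0)
    have hD := hM (t / (1 - t) - ⌊t / (1 - t)⌋₊) ⟨by linarith, by linarith⟩
    have hBk := hB ⌊t / (1 - t)⌋₊
    have hnn := D2_nonneg hΩ hf hpos hmain.1 (U ⌊t / (1 - t)⌋₊)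
    show D2 f (X ⌊t / (1 - t)⌋₊ + _ • U ⌊t / (1 - t)⌋₊) _ _ ≤ _
    simp only [map_smul, _root_.smul_apply, smul_eq_mul]
    have h12 : 1 / (1 - t) ^ 2 = (1 / (1 - t)) ^ 2 := by rw [div_pow, one_pow]
    rw [h12, hinv]
    set s := t / (1 - t)
    set k := ⌊s⌋₊
    set d := deriv Real.smoothTransition (s - k)
    set Q := D2 f (X k + Real.smoothTransition (s - k) • U k) (U k) (U k)
    have hp : (s + 1) ^ 4 ≤ ((k : ℝ) + 2) ^ 4 :=
      pow_le_pow_left₀ (by linarith) (by linarith) 4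
    have hM0 : 0 ≤ M := (sq_nonneg d).trans hD
    have e : (s + 1) ^ 2 * ((d * ((s + 1) ^ 2 * (d * Q)))) = (s + 1) ^ 4 * d ^ 2 * Q := by ring
    have h1 : (s + 1) ^ 4 * d ^ 2 * Q ≤ ((k : ℝ) + 2) ^ 4 * M * (4 * m k) :=
      mul_le_mul (mul_le_mul hp hD (sq_nonneg _) (by positivity)) hmain.2 hnn (by positivity)
    have h2 : 4 * M * (((k : ℝ) + 2) ^ 4 * m k) ≤ 4 * M * B :=
      mul_le_mul_of_nonneg_left hBk (by positivity)
    linarith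
end CV
end pieceg

section pieceh
open Matrix Set Filter Topology
open scoped ContDiff
set_option linter.unusedVariables false
set_option linter.unusedSectionVars false

set_option maxHeartbeats 1000000
section PK
variable {n : ℕ} {Ω : Set (Fin n → ℝ)} {f : (Fin n → ℝ) → ℝ}
variable (hΩ : IsOpen Ω) (hf : ContDiffOn ℝ (⊤ : ℕ∞) f Ω) (hpos : ∀ x ∈ Ω, (Hess n f x).PosDef)
include hΩ hf hpos

theorem picking (hcomplete : CalabiComplete n Ω f) {δ : ℝ} (hδ0 : 0 < δ) (hδ1 : δ ≤ 1)
    {o : Fin n → ℝ} (ho : o ∈ Ω) (hTo : 0 < Tf f o) :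
    ∃ x ∈ Ω, 0 < Tf f x ∧ ∀ u, D2 f x u u ≤ 1 / (4 * Tf f x ^ 2) → ∀ t ∈ Icc (0 : ℝ) 1,
      x + t • u ∈ Ω ∧ Tf f (x + t • u) ≤ (1 + δ) * Tf f x := by
  by_contra! hcon
  have step : ∀ x : {x // x ∈ Ω ∧ 0 < Tf f x}, ∃ u : Fin n → ℝ,
      D2 f x.1 u u ≤ 1 / (4 * Tf f x.1 ^ 2) ∧ (∀ t ∈ Icc (0 : ℝ) 1, x.1 + t • u ∈ Ω ∧
        D2 f (x.1 + t • u) u u ≤ 4 * D2 f x.1 u u) ∧ Tf f (x.1 + u) = (1 + δ) * Tf f x.1 := by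
    rintro ⟨x, hx, hT⟩
    obtain ⟨u, hu, t, ht, hbad⟩ := hcon x hx hT
    simp only
    have hm0 := D2_nonneg hΩ hf hpos hx u
    have hc : 0 ≤ (1 + δ) * Tf f x := by positivity
    have hcm : ((1 + δ) * Tf f x) ^ 2 * D2 f x u u ≤ 1 := by
      rw [le_div_iff₀ (by positivity)] at hu
      have h4 : (1 + δ) ^ 2 ≤ 4 := by nlinarith
      calc ((1 + δ) * Tf f x) ^ 2 * D2 f x u u = (1 + δ) ^ 2 * (Tf f x ^ 2 * D2 f x u u) := by ring
        _ ≤ 4 * (Tf f x ^ 2 * D2 f x u u) := mul_le_mul_of_nonneg_right h4 (by positivity)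
        _ ≤ 1 := by linarith
    rcases exit_lemma hΩ hf hpos hcomplete hc hx (by nlinarith) hcm with h | ⟨s, hs, hg, hTs⟩
    · exact absurd (h t ht).2 (not_le.2 (hbad (h t ht).1))
    · have hss : s ^ 2 ≤ 1 := by nlinarith [hs.1, hs.2]
      have e : D2 f x (s • u) (s • u) = s ^ 2 * D2 f x u u := by
        simp only [map_smul, _root_.smul_apply, smul_eq_mul]; ring
      refine ⟨s • u, ?_, ?_, hTs⟩
      · rw [e]; nlinarith
      · have hg' : ∀ t ∈ Icc (0 : ℝ) 1, x + t • (s • u) ∈ Ω ∧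
            Tf f (x + t • (s • u)) ≤ (1 + δ) * Tf f x := by
          intro t ht
          rw [smul_smul]
          exact hg _ ⟨mul_nonneg ht.1 hs.1, by nlinarith [ht.2, hs.1]⟩
        intro t ht
        refine ⟨(hg' t ht).1, (lemma_E hΩ hf hpos hc le_rfl hg' ?_ ht).2⟩
        rw [e]
        calc ((1 + δ) * Tf f x) ^ 2 * (s ^ 2 * D2 f x u u)
            = s ^ 2 * (((1 + δ) * Tf f x) ^ 2 * D2 f x u u) := by ring
          _ ≤ 1 * 1 := mul_le_mul hss hcm (by positivity) zero_le_one
          _ = 1 := one_mul 1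
  choose V hV1 hV2 hV3 using step
  have hnext : ∀ x : {x // x ∈ Ω ∧ 0 < Tf f x}, x.1 + V x ∈ Ω ∧ 0 < Tf f (x.1 + V x) := by
    intro x
    refine ⟨by simpa using (hV2 x 1 ⟨zero_le_one, le_rfl⟩).1, ?_⟩
    rw [hV3]; have := x.2.2; positivity
  let Y : ℕ → {x // x ∈ Ω ∧ 0 < Tf f x} := fun k =>
    Nat.rec ⟨o, ho, hTo⟩ (fun _ x => ⟨x.1 + V x, hnext x⟩) k
  have hYs : ∀ k, (Y (k + 1)).1 = (Y k).1 + V (Y k) := fun k => rfl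
  have hY0 : (Y 0).1 = o := rfl
  have hTY : ∀ k, Tf f (Y k).1 = (1 + δ) ^ k * Tf f o := by
    intro k
    induction k with
    | zero => simp [hY0]
    | succ k ih => rw [hYs, hV3, ih, pow_succ]; ring
  set r : ℝ := ((1 + δ) ^ 2)⁻¹ with hr
  have hr0 : 0 < r := by positivity
  have hr1 : r < 1 := inv_lt_one_of_one_lt₀ (by nlinarith)
  set C := 1 / (4 * Tf f o ^ 2) with hC
  have hm : ∀ k, D2 f (Y k).1 (V (Y k)) (V (Y k)) ≤ C * r ^ k := by
    intro k
    refine (hV1 (Y k)).trans (le_of_eq ?_)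
    rw [hTY, hC, hr, inv_pow, ← pow_mul, mul_pow, ← pow_mul, mul_comm k 2]
    have : 0 < (1 + δ) ^ (2 * k) := by positivity
    field_simp
  have ht0 : Tendsto (fun k : ℕ => C * r ^ k) atTop (𝓝 0) := by
    simpa using (tendsto_pow_atTop_nhds_zero_of_lt_one hr0.le hr1).const_mul C
  have ht4 : Tendsto (fun k : ℕ => ((k : ℝ) + 2) ^ 4 * (C * r ^ k)) atTop (𝓝 0) := by
    have h := (tendsto_pow_const_mul_const_pow_of_abs_lt_one 4 (r := r)
      (by rw [abs_of_pos hr0]; exact hr1)).comp (tendsto_add_atTop_nat 2)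
    have h' := h.const_mul (C / r ^ 2)
    rw [mul_zero] at h'
    refine h'.congr fun k => ?_
    simp only [Function.comp, Nat.cast_add, Nat.cast_ofNat, pow_add]
    field_simp
  obtain ⟨B, hB⟩ := ht4.bddAbove_range
  refine curve_contra hΩ hf hpos hcomplete (fun k => (Y k).1) (fun k => V (Y k))
    (fun k => C * r ^ k) hYs ?_ B (fun k => hB (mem_range_self k)) ht0 ?_
  · intro k t ht
    have := hV2 (Y k) t ht
    exact ⟨this.1, this.2.trans (by linarith [hm k])⟩
  · simp only [hTY]
    exact (tendsto_pow_atTop_atTop_of_one_lt (by linarith)).atTop_mul_const hTo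

theorem F_lower {x u : Fin n → ℝ} {q : ℝ}
    (hg : ∀ t ∈ Icc (0 : ℝ) 1, x + t • u ∈ Ω ∧ q ≤ D2 f (x + t • u) u u) :
    q / 2 ≤ f (x + u) - f x - fderiv ℝ f x u := by
  have d1 : ∀ t ∈ Icc (0 : ℝ) 1, HasDerivAt
      (fun t : ℝ => fderiv ℝ f (x + t • u) u - q * t) (D2 f (x + t • u) u u - q) t := by
    intro t ht
    have h1 := (hasDerivAt_line (D1h hΩ hf (hg t ht).1) (ln_hd x u t)).clm_apply
      (hasDerivAt_const t u)
    have h2 := h1.sub ((hasDerivAt_id t).const_mul q)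
    refine h2.congr_deriv (by simp)
  have m1 : MonotoneOn (fun t : ℝ => fderiv ℝ f (x + t • u) u - q * t) (Icc 0 1) := by
    refine monotoneOn_of_hasDerivWithinAt_nonneg (convex_Icc 0 1)
      (fun t ht => (d1 t ht).continuousAt.continuousWithinAt)
      (fun t ht => (d1 t (interior_subset ht)).hasDerivWithinAt) ?_
    intro t ht
    linarith [(hg t (interior_subset ht)).2]
  have d0 : ∀ t ∈ Icc (0 : ℝ) 1, HasDerivAt
      (fun t : ℝ => f (x + t • u) - t * fderiv ℝ f x u - q / 2 * t ^ 2)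
      (fderiv ℝ f (x + t • u) u - fderiv ℝ f x u - q * t) t := by
    intro t ht
    have h1 := hasDerivAt_line (smooth_hasFDerivAt hΩ hf (hg t ht).1) (ln_hd x u t)
    have h2 := (h1.sub ((hasDerivAt_id t).mul_const (fderiv ℝ f x u))).sub
      (((hasDerivAt_id t).pow 2).const_mul (q / 2))
    refine h2.congr_deriv ?_
    simp; ring
  have m0 : MonotoneOn (fun t : ℝ => f (x + t • u) - t * fderiv ℝ f x u - q / 2 * t ^ 2)
      (Icc 0 1) := by
    refine monotoneOn_of_hasDerivWithinAt_nonneg (convex_Icc 0 1)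
      (fun t ht => (d0 t ht).continuousAt.continuousWithinAt)
      (fun t ht => (d0 t (interior_subset ht)).hasDerivWithinAt) ?_
    intro t ht
    have ht' := interior_subset ht
    have := m1 (left_mem_Icc.2 zero_le_one) ht' ht'.1
    simp only [zero_smul, add_zero, mul_zero, sub_zero] at this
    linarith
  have := m0 (left_mem_Icc.2 zero_le_one) (right_mem_Icc.2 zero_le_one) zero_le_one
  simp only [zero_smul, add_zero, zero_mul, one_smul, sub_zero] at this
  norm_num at this
  linarith

theorem ell_compact {x : Fin n → ℝ} (hx : x ∈ Ω) (R : ℝ) : IsCompact {u | D2 f x u u ≤ R} := by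
  obtain ⟨l, hl, hlow⟩ := lower_bound hΩ hf hpos (K := {x}) isCompact_singleton (by simpa using hx)
  have hcl : IsClosed {u | D2 f x u u ≤ R} := by
    refine isClosed_le ?_ continuous_const
    exact ((D2 f x).continuous).clm_apply continuous_id
  refine Metric.isCompact_of_isClosed_isBounded hcl ?_
  refine (Metric.isBounded_closedBall (x := (0 : Fin n → ℝ)) (r := R / l + 1)).subset fun u hu => ?_
  rw [mem_closedBall_zero_iff]
  have h1 := (hlow x rfl u).trans hu
  have h2 : ‖u‖ ^ 2 ≤ R / l := by rw [le_div_iff₀ hl]; linarith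
  nlinarith [sq_nonneg (‖u‖ - 1)]

theorem T_zero (hn : 1 ≤ n) (hcomplete : CalabiComplete n Ω f)
    (hric : ∀ x ∈ Ω, ∀ i j : Fin n,
      pder n i (pder n j (fun y => Real.log (Hess n f y).det)) x = 0)
    {o : Fin n → ℝ} (ho : o ∈ Ω) : Tf f o = 0 := by
  by_contra hne
  have hTo : 0 < Tf f o := lt_of_le_of_ne (T_nonneg hΩ hf hpos hn ho) (Ne.symm hne)
  have hn' : (1 : ℝ) ≤ n := by exact_mod_cast hn
  set δ : ℝ := 1 / (385 * n) with hδ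
  have hδ0 : 0 < δ := by positivity
  have hδ1 : δ ≤ 1 := by rw [hδ, div_le_one (by positivity)]; linarith
  have hδn : δ * n = 1 / 385 := by rw [hδ]; field_simp
  obtain ⟨x, hx, hτ, hgood⟩ := picking hΩ hf hpos hcomplete hδ0 hδ1 ho hTo
  set τ := Tf f x with hτd
  set R := 1 / (4 * τ ^ 2) with hR
  set K := 64 * δ * τ ^ 3 with hK
  have hK0 : 0 < K := by positivity
  set L := fderiv ℝ f x with hL
  have hR4 : 4 * τ ^ 2 * R = 1 := by rw [hR]; field_simp
  let F : (Fin n → ℝ) → ℝ := fun y => f y - f x - L (y - x)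
  let S : Set (Fin n → ℝ) := (fun u => x + u) '' {u | D2 f x u u ≤ R}
  have hSc : IsCompact S := (ell_compact hΩ hf hpos hx R).image (by fun_prop)
  have hSΩ : S ⊆ Ω := by
    rintro _ ⟨u, hu, rfl⟩
    simpa using (hgood u hu 1 ⟨zero_le_one, le_rfl⟩).1
  have hFl : ∀ u, D2 f x u u ≤ R → D2 f x u u / 8 ≤ F (x + u) := by
    intro u hu
    have hm0 := D2_nonneg hΩ hf hpos hx u
    have := F_lower hΩ hf hpos (x := x) (u := u) (q := D2 f x u u / 4) (fun t ht =>
      ⟨(hgood u hu t ht).1, (lemma_E hΩ hf hpos (c := (1 + δ) * τ) (by positivity) le_rfl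
        (hgood u hu) (by
          have h4 : (1 + δ) ^ 2 ≤ 4 := by nlinarith
          calc ((1 + δ) * τ) ^ 2 * D2 f x u u = (1 + δ) ^ 2 * (τ ^ 2 * D2 f x u u) := by ring
            _ ≤ 4 * (τ ^ 2 * R) := mul_le_mul h4 (mul_le_mul_of_nonneg_left hu (by positivity))
                (by positivity) (by norm_num)
            _ = 1 := by linarith) ht).1⟩)
    have e : F (x + u) = f (x + u) - f x - L u := by simp [F]
    rw [e]; linarith
  have hFc : ContinuousOn F Ω := by
    refine (hf.continuousOn.sub continuousOn_const).sub ?_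
    exact (L.continuous.comp (continuous_id.sub continuous_const)).continuousOn
  have hGc : ContinuousOn (fun p : (Fin n → ℝ) × (Fin n → ℝ) => Wf f p.1 p.2 - K * F p.1)
      (S ×ˢ Sph n) := by
    refine ((W_cont hΩ hf hpos).mono (prod_mono_left hSΩ)).sub (continuousOn_const.mul ?_)
    exact (hFc.mono hSΩ).comp continuousOn_fst (fun p hp => hp.1)
  have hR0 : 0 < R := by positivity
  have hxS : x ∈ S := ⟨0, by simpa using hR0.le, by simp⟩
  obtain ⟨v0, hv0, hWv0⟩ := T_max hΩ hf hpos hn hx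
  obtain ⟨⟨y, v⟩, ⟨hyS, hvS⟩, hmax⟩ := (hSc.prod Sph_compact).exists_isMaxOn ⟨(x, v0), hxS, hv0⟩ hGc
  simp only at hyS hvS
  have hmax' : ∀ z ∈ S, ∀ w ∈ Sph n, Wf f z w - K * F z ≤ Wf f y v - K * F y :=
    fun z hz w hw => hmax (show (z, w) ∈ S ×ˢ Sph n from ⟨hz, hw⟩)
  have hge : τ ≤ Wf f y v - K * F y := by
    have := hmax' x hxS v0 hv0
    rw [hWv0] at this
    simpa [F] using this
  have hyΩ := hSΩ hyS
  have hv_ne := Sph_ne hvS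
  obtain ⟨u, hu, hyu⟩ := hyS
  simp only at hyu
  have hu' : D2 f x u u ≤ R := hu
  have hm0 := D2_nonneg hΩ hf hpos hx u
  have hFy := hFl u hu'
  rw [hyu] at hFy
  have hTy : Wf f y v ≤ (1 + δ) * τ := by
    refine (W_le hΩ hf hpos hyΩ hv_ne).trans ?_
    have := (hgood u hu' 1 ⟨zero_le_one, le_rfl⟩).2
    simpa [hyu] using this
  have hKF : K * (D2 f x u u / 8) ≤ δ * τ := by
    have := mul_le_mul_of_nonneg_left hFy hK0.le
    linarith
  have hsmall : D2 f x u u < R := by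
    by_contra hcon
    push Not at hcon
    have : K * (R / 8) ≤ K * (D2 f x u u / 8) :=
      mul_le_mul_of_nonneg_left (by linarith) hK0.le
    have e : K * (R / 8) = 2 * (δ * τ) := by
      rw [hK]
      calc 64 * δ * τ ^ 3 * (R / 8) = 2 * δ * τ * (4 * τ ^ 2 * R) := by ring
        _ = _ := by rw [hR4]; ring
    have : 0 < δ * τ := by positivity
    linarith
  have hFy0 : 0 ≤ K * F y := mul_nonneg hK0.le (by linarith)
  set τy := Wf f y v with hτy
  have hττ : τ ≤ τy := by linarith
  have hτy0 : 0 < τy := by linarith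
  have hnear : ∀ᶠ z in 𝓝 y, z ∈ S := by
    have hc : Continuous fun z : Fin n → ℝ => D2 f x (z - x) (z - x) :=
      ((D2 f x).continuous.comp (continuous_id.sub continuous_const)).clm_apply
        (continuous_id.sub continuous_const)
    have hyx : y - x = u := by rw [← hyu]; simp
    have : ∀ᶠ z in 𝓝 y, D2 f x (z - x) (z - x) < R :=
      hc.continuousAt.eventually (gt_mem_nhds (by simp only [hyx]; exact hsmall))
    filter_upwards [this] with z hz
    exact ⟨z - x, hz.le, by simp⟩
  have hpol : ∀ᶠ z in 𝓝 y, ∀ w, 2 * D3 f z w w w ≤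
      (τy + K * (f z - f y - L (z - y))) * (D2 f z w w + (D2 f z w w) ^ 2) := by
    filter_upwards [hnear] with z hz w
    by_cases hw : w = 0
    · simp [hw]
    have hzΩ := hSΩ hz
    have eF : τy + K * (f z - f y - L (z - y)) = τy - K * F y + K * F z := by
      simp only [F, map_sub]; ring
    rw [eF]
    have hW : ∀ w : Fin n → ℝ, w ≠ 0 → Wf f z w ≤ τy - K * F y + K * F z := by
      intro w hw
      have := hmax' z hz _ (Sph_norm hw)
      rw [W_smul hΩ hf hpos hzΩ hw (by positivity)] at this
      linarith
    have h1 := hW w hw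
    have h2 := hW (-w) (neg_ne_zero.2 hw)
    rw [W_neg hΩ hf hpos] at h2
    set C := τy - K * F y + K * F z
    have hC0 : 0 ≤ C := by linarith
    have hs := D2_pos hΩ hf hpos hzΩ hw
    have hq := Real.sqrt_pos.2 hs
    have hsq := Real.sq_sqrt hs.le
    unfold Wf at h1
    rw [div_le_iff₀ (by positivity)] at h1
    set s := D2 f z w w
    have h3 : 2 * (s * √s) ≤ s + s ^ 2 := by
      have h4 := mul_nonneg hs.le (sq_nonneg (√s - 1))
      have h5 : s * (√s - 1) ^ 2 = s * √s ^ 2 - 2 * (s * √s) + s := by ring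
      rw [h5, hsq] at h4
      linarith
    linarith [mul_le_mul_of_nonneg_left h3 hC0]
  have hs := D2_pos hΩ hf hpos hyΩ hv_ne
  have hq := Real.sqrt_pos.2 hs
  have hsq := Real.sq_sqrt hs.le
  have hv1 : D2 f y ((√(D2 f y v v))⁻¹ • v) ((√(D2 f y v v))⁻¹ • v) = 1 := by
    simp only [map_smul, _root_.smul_apply, smul_eq_mul]
    set s := D2 f y v v
    have : (√s)⁻¹ * ((√s)⁻¹ * s) = (√s ^ 2)⁻¹ * s := by ring
    rw [this, hsq, inv_mul_cancel₀ hs.ne']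
  have hW1 : D3 f y ((√(D2 f y v v))⁻¹ • v) ((√(D2 f y v v))⁻¹ • v) ((√(D2 f y v v))⁻¹ • v) = τy := by
    have := W_smul hΩ hf hpos hyΩ hv_ne (c := (√(D2 f y v v))⁻¹) (by positivity)
    rw [hτy, ← this]
    unfold Wf
    rw [hv1]; simp
  have hfin := lemma_D hΩ hf hpos hric hyΩ hτy0 L hv1 hW1 hpol
  have h3 : τ ^ 3 ≤ τy ^ 3 := pow_le_pow_left₀ hτ.le hττ 3
  have e : 6 * K * n = 384 * (δ * n) * τ ^ 3 := by rw [hK]; ring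
  rw [e, hδn] at hfin
  have : 0 < τ ^ 3 := by positivity
  linarith

theorem final_quad (hn : 1 ≤ n) (hcomplete : CalabiComplete n Ω f)
    (hric : ∀ x ∈ Ω, ∀ i j : Fin n,
      pder n i (pder n j (fun y => Real.log (Hess n f y).det)) x = 0) : IsQuadraticOn n Ω f := by
  rcases Ω.eq_empty_or_nonempty with h | ⟨o, ho⟩
  · exact ⟨1, Matrix.isSymm_one, Matrix.PosDef.one, 0, 0, by simp [h]⟩
  have hT0 : ∀ x ∈ Ω, Tf f x = 0 := fun x hx => T_zero hΩ hf hpos hn hcomplete hric hx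
  have huniv : ∀ z, z ∈ Ω := by
    intro z
    have hm0 := D2_nonneg hΩ hf hpos ho (z - o)
    set m := D2 f o (z - o) (z - o)
    have hc : 0 < 1 / (1 + m) := by positivity
    rcases exit_lemma hΩ hf hpos hcomplete (x := o) (u := z - o) hc.le ho
      (by rw [hT0 o ho]; exact hc.le) (by
        rw [div_pow, one_pow, div_mul_eq_mul_div, one_mul]
        exact div_le_one_of_le₀ (by nlinarith) (by positivity)) with h | ⟨s, hs, hg, hTs⟩
    · simpa using (h 1 ⟨zero_le_one, le_rfl⟩).1
    · rw [hT0 _ (hg s ⟨hs.1, le_rfl⟩).1] at hTs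
      linarith
  have h3 : ∀ x v, D3 f x v v v = 0 := by
    intro x v
    have := D3_le hΩ hf hpos (huniv x) v
    rw [hT0 x (huniv x), zero_mul] at this
    exact abs_nonpos_iff.1 this
  refine ⟨Hess n f 0, ?_, hpos 0 (huniv 0), fun i => fderiv ℝ f 0 (Pi.single i 1), f 0, ?_⟩
  · ext i j
    rw [Matrix.transpose_apply, Hess_apply hΩ hf (huniv 0), Hess_apply hΩ hf (huniv 0),
      D2_symm hΩ hf (huniv 0)]
  intro z _
  have hlin : (fun i => fderiv ℝ f 0 (Pi.single i 1)) ⬝ᵥ z = fderiv ℝ f 0 z := by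
    conv_rhs => rw [vec_expand z]
    simp only [map_sum, map_smul, smul_eq_mul, dotProduct]
    exact Finset.sum_congr rfl fun i _ => mul_comm _ _
  rw [Hess_quad hΩ hf (huniv 0), hlin]
  have c2 : ∀ t : ℝ, D2 f (0 + t • z) z z = D2 f 0 z z := by
    have hd : ∀ t : ℝ, HasDerivAt (fun t : ℝ => D2 f (0 + t • z) z z) 0 t := by
      intro t
      have h1 := der_s hΩ hf (v := z) (η := 0) (huniv (0 + t • z))
      simp only [smul_zero, add_zero, map_zero, _root_.zero_apply, mul_zero, h3] at h1
      exact h1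
    intro t
    have := is_const_of_deriv_eq_zero (fun t => (hd t).differentiableAt) (fun t => (hd t).deriv) t 0
    simpa using this
  have up := F_lower hΩ hf hpos (x := 0) (u := z) (q := D2 f 0 z z)
    (fun t _ => ⟨huniv _, (c2 t).ge⟩)
  have dn := F_lower hΩ hf hpos (x := z) (u := -z) (q := D2 f 0 z z) (fun t _ => ⟨huniv _, by
    have := (c2 (1 - t)).ge
    have e : z + t • -z = 0 + (1 - t) • z := by rw [sub_smul, one_smul, smul_neg]; abel
    rw [e]; simpa using this⟩)
  have c1 : fderiv ℝ f z z = fderiv ℝ f 0 z + D2 f 0 z z := by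
    have hd : ∀ t : ℝ, HasDerivAt (fun t : ℝ => fderiv ℝ f (0 + t • z) z - t * D2 f 0 z z) 0 t := by
      intro t
      have h1 := (hasDerivAt_line (D1h hΩ hf (huniv (0 + t • z))) (ln_hd 0 z t)).clm_apply
        (hasDerivAt_const t z)
      have h2 := h1.sub ((hasDerivAt_id t).mul_const (D2 f 0 z z))
      refine h2.congr_deriv ?_
      rw [c2]; simp
    have := is_const_of_deriv_eq_zero (fun t => (hd t).differentiableAt) (fun t => (hd t).deriv) 1 0
    simp at this
    linarith
  simp only [zero_add, map_neg, add_neg_cancel, c1] at up dn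
  linarith
end PK
end pieceh

/-- **Theorem 3 (paper).** A smooth strictly convex function on an open set `Ω ⊆ ℝⁿ`
which is affine Kähler Ricci flat and whose Calabi metric is complete is a quadratic
polynomial. -/
theorem affine_kahler_ricci_flat_complete_implies_quadratic
    (n : ℕ) (hn : 1 ≤ n) (Ω : Set (Fin n → ℝ)) (hΩ : IsOpen Ω)
    (f : (Fin n → ℝ) → ℝ) (hf : ContDiffOn ℝ (⊤ : ℕ∞) f Ω)
    (hpos : ∀ x ∈ Ω, (Hess n f x).PosDef)
    (hric : ∀ x ∈ Ω, ∀ i j : Fin n,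
      pder n i (pder n j (fun y => Real.log (Hess n f y).det)) x = 0)
    (hcomplete : CalabiComplete n Ω f) :
    IsQuadraticOn n Ω f := by
  exact final_quad hΩ hf hpos hn hcomplete hric
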